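/- arXiv:1103.1834 — 5 statements merged into one kernel-verified Lean document; each statement's English description precedes it below -/
import Mathlib

section
/- Let T = {T_1, ..., T_m} be a set of m rooted phylogenetic trees on a finite taxa set X and let C = Cl(T). Let S be a maximal non-trivial ST-set of C. Let N be any rooted phylogenetic network on X\S that represents C\S. Then there exists a rooted phylogenetic network N' on X that represents C such that r(N') ≤ r(N) + (m−1). -/
open scoped Classical

namespace Phylo

variable {α : Type} [DecidableEq α]

/-- A finite directed graph whose vertices carry labels from `α`; used to model
rooted phylogenetic networks and trees. -/
structure Net (α : Type) where
  n : ℕ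
  E : Finset (Fin n × Fin n)
  label : Fin n → α

namespace Net

def indeg (N : Net α) (v : Fin N.n) : ℕ := (N.E.filter fun e => e.2 = v).card

def outdeg (N : Net α) (v : Fin N.n) : ℕ := (N.E.filter fun e => e.1 = v).card

def Adj (N : Net α) (u v : Fin N.n) : Prop := (u, v) ∈ N.E

def Reaches (N : Net α) : Fin N.n → Fin N.n → Prop := Relation.ReflTransGen N.Adj

def IsLeaf (N : Net α) (v : Fin N.n) : Prop := N.outdeg v = 0

/-- The set of labels of leaves reachable from `v` by directed paths. -/
noncomputable def clusterBelow (N : Net α) (v : Fin N.n) : Finset α :=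
  (Finset.univ.filter fun w => N.Reaches v w ∧ N.IsLeaf w).image N.label

/-- The reticulation number `r(N) = Σ_{v : indeg(v) > 0} (indeg(v) - 1)`. -/
def reticNum (N : Net α) : ℕ := ∑ v, (N.indeg v - 1)

end Net

/-- `N` is a rooted phylogenetic network on the taxa set `X`: an acyclic digraph with a
unique root (indegree-0 node), no node with indegree 1 and outdegree 1, every
reticulation (indegree ≥ 2) having outdegree ≥ 1, and leaves bijectively labeled by `X`. -/
def IsPhyloNet (X : Finset α) (N : Net α) : Prop :=
  (∀ v : Fin N.n, ¬ Relation.TransGen N.Adj v v) ∧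
  (∃! ρ : Fin N.n, N.indeg ρ = 0) ∧
  (∀ v : Fin N.n, ¬ (N.indeg v = 1 ∧ N.outdeg v = 1)) ∧
  (∀ v : Fin N.n, 2 ≤ N.indeg v → 1 ≤ N.outdeg v) ∧
  Set.BijOn N.label {v | N.IsLeaf v} (X : Set α)

/-- A rooted phylogenetic tree on `X` is a network on `X` with reticulation number 0. -/
def IsPhyloTree (X : Finset α) (N : Net α) : Prop := IsPhyloNet X N ∧ N.reticNum = 0

/-- A network is binary if every reticulation has indegree 2 and outdegree 1 and every
non-leaf tree node has outdegree 2. -/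
def IsBinary (N : Net α) : Prop :=
  ∀ v : Fin N.n, (N.indeg v ≤ 1 → N.outdeg v = 0 ∨ N.outdeg v = 2) ∧
    (2 ≤ N.indeg v → N.indeg v = 2 ∧ N.outdeg v = 1)

/-- The internal vertices of a path given as a list of vertices. -/
def internals {β : Type*} (p : List β) : List β := p.tail.dropLast

def IsDirPath (N : Net α) (u v : Fin N.n) (p : List (Fin N.n)) : Prop :=
  p.head? = some u ∧ p.getLast? = some v ∧ p.Chain' N.Adj ∧ 2 ≤ p.length

/-- `N` displays `T`: `T` can be obtained from `N` by deleting nodes and edges and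
suppressing indegree-1 outdegree-1 nodes, formalized as a topological embedding:
each edge of `T` maps to a directed path of `N`, paths being internally disjoint
from each other and from the images of the nodes of `T`, and leaves of `T` map to
leaves of `N` with the same label. -/
def Displays (N T : Net α) : Prop :=
  ∃ φ : Fin T.n → Fin N.n, Function.Injective φ ∧
    (∀ v, T.IsLeaf v → N.IsLeaf (φ v) ∧ N.label (φ v) = T.label v) ∧
    ∃ P : Fin T.n × Fin T.n → List (Fin N.n),
      (∀ e ∈ T.E, IsDirPath N (φ e.1) (φ e.2) (P e)) ∧
      (∀ e ∈ T.E, ∀ w ∈ internals (P e), w ∉ Set.range φ) ∧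
      (∀ e ∈ T.E, ∀ f ∈ T.E, e ≠ f → ∀ w ∈ internals (P e), w ∉ internals (P f))

/-- `N` represents the cluster `C` in the softwired sense: some tree on `X` displayed by
`N` has an edge whose set of leaf descendants is exactly `C`. -/
def RepresentsCluster (X : Finset α) (N : Net α) (C : Finset α) : Prop :=
  ∃ T : Net α, IsPhyloTree X T ∧ Displays N T ∧ ∃ e ∈ T.E, T.clusterBelow e.2 = C

def RepresentsSet (X : Finset α) (N : Net α) (𝒞 : Set (Finset α)) : Prop :=
  ∀ C ∈ 𝒞, RepresentsCluster X N C

/-- `Cl(T)`: the set of clusters represented by edges of the tree `T`. -/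
def clSet (T : Net α) : Set (Finset α) := {C | ∃ e ∈ T.E, T.clusterBelow e.2 = C}

/-- `r(𝒞)`: the minimum reticulation number of a network on `X` representing `𝒞`. -/
noncomputable def rNum (X : Finset α) (𝒞 : Set (Finset α)) : ℕ :=
  sInf {k | ∃ N : Net α, IsPhyloNet X N ∧ RepresentsSet X N 𝒞 ∧ N.reticNum = k}

/-- A cluster on `X` is a nonempty proper subset of `X`. -/
def IsCluster (X C : Finset α) : Prop := C ⊆ X ∧ C.Nonempty ∧ C ≠ X

def IsClusterSet (X : Finset α) (𝒞 : Set (Finset α)) : Prop := ∀ C ∈ 𝒞, IsCluster X C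

def Compatible (A B : Finset α) : Prop := A ∩ B = ∅ ∨ A ⊆ B ∨ B ⊆ A

/-- `𝒞 \ S`: remove the elements of `S` from each cluster, discarding emptied clusters. -/
def removeTaxa (𝒞 : Set (Finset α)) (S : Finset α) : Set (Finset α) :=
  {D | D.Nonempty ∧ ∃ C ∈ 𝒞, D = C \ S}

/-- `𝒞 | S`: the restriction of `𝒞` to `S`. -/
def restrictTo (𝒞 : Set (Finset α)) (S : Finset α) : Set (Finset α) :=
  {D | D.Nonempty ∧ ∃ C ∈ 𝒞, D = C ∩ S}

/-- `S` is unseparated by `𝒞`: no cluster of `𝒞` is incompatible with `S`. -/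
def Unseparated (𝒞 : Set (Finset α)) (S : Finset α) : Prop := ∀ C ∈ 𝒞, Compatible C S

/-- `𝒞` separates every proper subset of `X` with at least two elements. -/
def Separating (X : Finset α) (𝒞 : Set (Finset α)) : Prop :=
  ∀ X' : Finset α, X' ⊂ X → 2 ≤ X'.card → ∃ C ∈ 𝒞, ¬ Compatible C X'

def PairwiseCompatible (𝒞 : Set (Finset α)) : Prop := ∀ A ∈ 𝒞, ∀ B ∈ 𝒞, Compatible A B

/-- `S` is an ST-set with respect to `𝒞`. -/
def IsSTSet (X : Finset α) (𝒞 : Set (Finset α)) (S : Finset α) : Prop :=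
  S ⊆ X ∧ Unseparated 𝒞 S ∧ PairwiseCompatible (restrictTo 𝒞 S)

/-- `S` is a maximal ST-set: no ST-set properly contains it. -/
def IsMaxSTSet (X : Finset α) (𝒞 : Set (Finset α)) (S : Finset α) : Prop :=
  IsSTSet X 𝒞 S ∧ ∀ S', IsSTSet X 𝒞 S' → ¬ S ⊂ S'

/-- `(S₁, …, S_p)` is a maximal ST-set sequence of `𝒞`. -/
def IsMaxSTSeq : Finset α → Set (Finset α) → List (Finset α) → Prop
  | _, _, [] => True
  | X, 𝒞, S :: L => IsMaxSTSet X 𝒞 S ∧ IsMaxSTSeq (X \ S) (removeTaxa 𝒞 S) L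

/-- `(S₁, …, S_p)` is an ST-set sequence of `𝒞` (empty ST-sets allowed). -/
def IsSTSeq : Finset α → Set (Finset α) → List (Finset α) → Prop
  | _, _, [] => True
  | X, 𝒞, S :: L => IsSTSet X 𝒞 S ∧ IsSTSeq (X \ S) (removeTaxa 𝒞 S) L

def removeAll (𝒞 : Set (Finset α)) (L : List (Finset α)) : Set (Finset α) :=
  L.foldl removeTaxa 𝒞

/-- A maximal ST-set *tree* sequence: additionally the remaining clusters are pairwise
compatible. -/
def IsMaxSTTreeSeq (X : Finset α) (𝒞 : Set (Finset α)) (L : List (Finset α)) : Prop :=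
  IsMaxSTSeq X 𝒞 L ∧ PairwiseCompatible (removeAll 𝒞 L)

def IsSTTreeSeq (X : Finset α) (𝒞 : Set (Finset α)) (L : List (Finset α)) : Prop :=
  IsSTSeq X 𝒞 L ∧ PairwiseCompatible (removeAll 𝒞 L)

/-- The MST lower bound: minimum length of a maximal ST-set tree sequence of `𝒞`. -/
noncomputable def mstLB (X : Finset α) (𝒞 : Set (Finset α)) : ℕ :=
  sInf {p | ∃ L, IsMaxSTTreeSeq X 𝒞 L ∧ L.length = p}

/- Underlying undirected notions, biconnected components and the level of a network. -/

def uadj (N : Net α) (F : Finset (Fin N.n × Fin N.n)) (u v : Fin N.n) : Prop :=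
  (u, v) ∈ F ∨ (v, u) ∈ F

def verts (N : Net α) (F : Finset (Fin N.n × Fin N.n)) : Finset (Fin N.n) :=
  F.image Prod.fst ∪ F.image Prod.snd

def ConnOn (N : Net α) (F : Finset (Fin N.n × Fin N.n)) : Prop :=
  ∀ u ∈ verts N F, ∀ v ∈ verts N F, Relation.ReflTransGen (uadj N F) u v

def delVert (N : Net α) (F : Finset (Fin N.n × Fin N.n)) (v : Fin N.n) :
    Finset (Fin N.n × Fin N.n) :=
  F.filter fun e => e.1 ≠ v ∧ e.2 ≠ v

def HasCutNodeOn (N : Net α) (F : Finset (Fin N.n × Fin N.n)) : Prop :=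
  ∃ v ∈ verts N F, ∃ a ∈ verts N F, ∃ b ∈ verts N F, a ≠ v ∧ b ≠ v ∧
    ¬ Relation.ReflTransGen (uadj N (delVert N F v)) a b

/-- The (edge set of a) subgraph is biconnected: connected and without cut-nodes. -/
def Biconn (N : Net α) (F : Finset (Fin N.n × Fin N.n)) : Prop :=
  F.Nonempty ∧ ConnOn N F ∧ ¬ HasCutNodeOn N F

/-- `F` is a biconnected component of `N`: a maximal biconnected subgraph. -/
def IsBCC (N : Net α) (F : Finset (Fin N.n × Fin N.n)) : Prop :=
  F ⊆ N.E ∧ Biconn N F ∧ ∀ F', F' ⊆ N.E → Biconn N F' → F ⊆ F' → F' = F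

/-- Reticulation number of a biconnected component, indegrees computed within it. -/
def compRetic (N : Net α) (F : Finset (Fin N.n × Fin N.n)) : ℕ :=
  ∑ v ∈ verts N F, ((F.filter fun e => e.2 = v).card - 1)

/-- The level of `N`: the maximum reticulation number of a biconnected component. -/
noncomputable def level (N : Net α) : ℕ :=
  sSup {k | ∃ F, IsBCC N F ∧ compRetic N F = k}

def IsCutEdge (N : Net α) (e : Fin N.n × Fin N.n) : Prop :=
  e ∈ N.E ∧ ∃ a b : Fin N.n, ¬ Relation.ReflTransGen (uadj N (N.E.erase e)) a b

def IsCutNode (N : Net α) (v : Fin N.n) : Prop :=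
  ∃ a b : Fin N.n, a ≠ v ∧ b ≠ v ∧
    ¬ Relation.ReflTransGen (uadj N (delVert N N.E v)) a b

/-- `N` is simple: removal of any cut-node or cut-edge leaves at most one non-trivial
connected component (all remaining edges lie in a single component). -/
def IsSimpleNet (N : Net α) : Prop :=
  (∀ v : Fin N.n, IsCutNode N v → ∀ f ∈ delVert N N.E v, ∀ g ∈ delVert N N.E v,
      Relation.ReflTransGen (uadj N (delVert N N.E v)) f.1 g.1) ∧
  (∀ e : Fin N.n × Fin N.n, IsCutEdge N e → ∀ f ∈ N.E.erase e, ∀ g ∈ N.E.erase e,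
      Relation.ReflTransGen (uadj N (N.E.erase e)) f.1 g.1)

/-- The non-trivial ST-set `S` is under a cut-edge of `N`: `N` has a cut-edge `(u,v)`
such that the subnetwork rooted at `v` is a tree whose taxa set is `S` and which
represents the cluster set `𝒞 | S`. -/
def UnderCutEdge (𝒞 : Set (Finset α)) (N : Net α) (S : Finset α) : Prop :=
  ∃ e ∈ N.E, IsCutEdge N e ∧ N.clusterBelow e.2 = S ∧
    (∀ w : Fin N.n, N.Reaches e.2 w →
      (N.E.filter fun f => f.2 = w ∧ N.Reaches e.2 f.1).card ≤ 1) ∧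
    ∀ C ∈ restrictTo 𝒞 S, ∃ f ∈ N.E, N.Reaches e.2 f.1 ∧ N.clusterBelow f.2 = C

/-- The subnetwork of `N` rooted at `v` is exactly (isomorphic to) `T`. -/
def IsoSubnetAt (N : Net α) (v : Fin N.n) (T : Net α) : Prop :=
  ∃ g : Fin T.n → Fin N.n, Function.Injective g ∧
    Set.range g = {w | N.Reaches v w} ∧
    (∀ a b : Fin T.n, (a, b) ∈ T.E ↔ (g a, g b) ∈ N.E) ∧
    ∀ a : Fin T.n, T.IsLeaf a → N.label (g a) = T.label a

/-- `T` is a subtree below a reticulation (SBR) of `N`. -/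
def IsSBR (N T : Net α) : Prop :=
  ∃ v : Fin N.n, 2 ≤ N.indeg v ∧
    (∀ w : Fin N.n, N.Reaches v w → w ≠ v → N.indeg w < 2) ∧
    ((N.outdeg v = 1 ∧ ∃ c : Fin N.n, (v, c) ∈ N.E ∧ IsoSubnetAt N c T) ∨
     (N.outdeg v ≠ 1 ∧ IsoSubnetAt N v T))

/-- `T'` is a (not necessarily binary) refinement of `T`: a tree on `X` with
`Cl(T) ⊆ Cl(T')`. -/
def IsRefinement (X : Finset α) (T T' : Net α) : Prop :=
  IsPhyloTree X T' ∧ clSet T ⊆ clSet T'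

/-- `h⁰(𝒯)`: minimum reticulation number of a network on `X` displaying some
refinement of each tree of the family. -/
noncomputable def h0 (X : Finset α) {m : ℕ} (T : Fin m → Net α) : ℕ :=
  sInf {k | ∃ N : Net α, IsPhyloNet X N ∧
    (∀ i, ∃ T', IsRefinement X (T i) T' ∧ Displays N T') ∧ N.reticNum = k}

/-- `h⁻(𝒯)`: minimum reticulation number of a network on `X` displaying some *binary*
refinement of each tree of the family. -/
noncomputable def hminus (X : Finset α) {m : ℕ} (T : Fin m → Net α) : ℕ :=
  sInf {k | ∃ N : Net α, IsPhyloNet X N ∧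
    (∀ i, ∃ T', IsRefinement X (T i) T' ∧ IsBinary T' ∧ Displays N T') ∧ N.reticNum = k}

/-- `N` is consistent with the rooted triplet `xy|z`: it displays the binary tree on
`{x,y,z}` in which `{x,y}` is a cluster. -/
def ConsistentTriplet (N : Net α) (x y z : α) : Prop :=
  ∃ t : Net α, IsPhyloTree ({x, y, z} : Finset α) t ∧ IsBinary t ∧
    (∃ e ∈ t.E, t.clusterBelow e.2 = ({x, y} : Finset α)) ∧ Displays N t

/-- `r_tr(𝒯)`: minimum reticulation number of a network on `X` consistent with every
rooted triplet consistent with some tree of the family. -/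
noncomputable def rtr (X : Finset α) {m : ℕ} (T : Fin m → Net α) : ℕ :=
  sInf {k | ∃ N : Net α, IsPhyloNet X N ∧
    (∀ x y z : α, x ≠ y → y ≠ z → x ≠ z →
      (∃ i, ConsistentTriplet (T i) x y z) → ConsistentTriplet N x y z) ∧
    N.reticNum = k}

/-- `𝒞_{U → u}`: replace all elements of `U` in every cluster by the single taxon `u`. -/
def collapseTo (𝒞 : Set (Finset α)) (U : Finset α) (u : α) : Set (Finset α) :=
  {D | ∃ C ∈ 𝒞, D = if (C ∩ U).Nonempty then (C \ U) ∪ {u} else C}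

section Rel

variable {V W V' W' : Type}

def Lf (E : V → V → Prop) (v : V) : Prop := ∀ w, ¬ E v w

def Rt (E : V → V → Prop) (v : V) : Prop := ∀ u, ¬ E u v

structure PN (X : Finset α) (E : V → V → Prop) (l : V → α) : Prop where
  acyc : ∀ v, ¬ Relation.TransGen E v v
  root : ∃! ρ, Rt E ρ
  nosup : ∀ v, ¬ ((∃! u, E u v) ∧ (∃! w, E v w))
  leafin : ∀ v, Lf E v → ∀ u u', E u v → E u' v → u = u'
  bij : Set.BijOn l {v | Lf E v} (X : Set α)

def Tr (E : V → V → Prop) : Prop := ∀ u u' v, E u v → E u' v → u = u'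

def clus (E : V → V → Prop) (l : V → α) (v : V) : Set α :=
  {a | ∃ w, Relation.ReflTransGen E v w ∧ Lf E w ∧ l w = a}

structure Emb (E : V → V → Prop) (l : V → α) (E' : V' → V' → Prop) (l' : V' → α)
    (φ : V' → V) (Q : V' → V' → List V) : Prop where
  inj : Function.Injective φ
  leaf : ∀ v, Lf E' v → Lf E (φ v) ∧ l (φ v) = l' v
  path : ∀ u v, E' u v → List.IsChain E (φ u :: (Q u v ++ [φ v]))
  avoid : ∀ u v, E' u v → ∀ w ∈ Q u v, ∀ t, φ t ≠ w
  disj : ∀ u v u' v', E' u v → E' u' v' → (u, v) ≠ (u', v') → ∀ w ∈ Q u v, w ∉ Q u' v'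

noncomputable def rr [Fintype V] (E : V → V → Prop) : ℕ := ∑ v, (({u | E u v} : Set V).ncard - 1)

/-! transfer -/


end Rel
section Transfer

theorem indeg_eq (N : Net α) (v : Fin N.n) : N.indeg v = ({u | N.Adj u v} : Set _).ncard := by
  unfold Net.indeg
  rw [← Set.ncard_coe_finset]
  symm
  apply Set.ncard_congr (fun u _ => (u, v))
  · intro a h; simpa [Net.Adj] using h
  · intro a b _ _ h; simpa using h
  · rintro ⟨a, b⟩ h
    simp at h
    exact ⟨a, by simpa [Net.Adj, ← h.2] using h.1, by simp [h.2]⟩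

theorem outdeg_eq (N : Net α) (v : Fin N.n) : N.outdeg v = ({u | N.Adj v u} : Set _).ncard := by
  unfold Net.outdeg
  rw [← Set.ncard_coe_finset]
  symm
  apply Set.ncard_congr (fun u _ => (v, u))
  · intro a h; simpa [Net.Adj] using h
  · intro a b _ _ h; simpa using h
  · rintro ⟨a, b⟩ h
    simp at h
    exact ⟨b, by simpa [Net.Adj, ← h.2] using h.1, by simp [h.2]⟩

theorem ncard_zero_iff {V : Type} [Finite V] (P : V → Prop) :
    ({u | P u} : Set V).ncard = 0 ↔ ∀ u, ¬ P u := by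
  rw [Set.ncard_eq_zero (Set.toFinite _)]
  simp [Set.eq_empty_iff_forall_notMem]

theorem ncard_one_iff {V : Type} (P : V → Prop) :
    ({u | P u} : Set V).ncard = 1 ↔ ∃! u, P u := by
  rw [Set.ncard_eq_one]
  constructor
  · rintro ⟨a, h⟩
    refine ⟨a, ?_, ?_⟩
    · have : a ∈ ({u | P u} : Set V) := by rw [h]; rfl
      exact this
    · intro b hb
      have : b ∈ ({u | P u} : Set V) := hb
      rw [h] at this; exact this
  · rintro ⟨a, h, h2⟩
    refine ⟨a, ?_⟩
    ext b
    constructor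
    · exact h2 b
    · rintro rfl; exact h

theorem ncard_le_one_iff' {V : Type} [Finite V] (P : V → Prop) :
    ({u | P u} : Set V).ncard ≤ 1 ↔ ∀ u u', P u → P u' → u = u' := by
  rw [Set.ncard_le_one (Set.toFinite _)]
  simp only [Set.mem_ofPred_eq]
  constructor
  · intro h u u' a b; exact h u a u' b
  · intro h u a u' b; exact h u u' a b

theorem isLeaf_iff (N : Net α) (v : Fin N.n) : N.IsLeaf v ↔ Lf N.Adj v := by
  unfold Net.IsLeaf Lf
  rw [outdeg_eq, ncard_zero_iff]

theorem isPhyloNet_iff (X : Finset α) (N : Net α) : IsPhyloNet X N ↔ PN X N.Adj N.label := by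
  have hs : {v | N.IsLeaf v} = {v | Lf N.Adj v} := by
    ext v; exact isLeaf_iff N v
  unfold IsPhyloNet
  rw [hs]
  have h4 : (∀ v : Fin N.n, 2 ≤ N.indeg v → 1 ≤ N.outdeg v) ↔
      ∀ v, Lf N.Adj v → ∀ u u', N.Adj u v → N.Adj u' v → u = u' := by
    apply forall_congr'
    intro v
    rw [indeg_eq, outdeg_eq, ← ncard_le_one_iff' (fun u => N.Adj u v)]
    unfold Lf
    rw [← ncard_zero_iff (fun w => N.Adj v w)]
    omega
  rw [h4]
  simp only [indeg_eq, outdeg_eq, ncard_one_iff, ncard_zero_iff (fun u => N.Adj u _)]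
  constructor
  · rintro ⟨a, b, c, d, e⟩; exact ⟨a, b, c, d, e⟩
  · rintro ⟨a, b, c, d, e⟩; exact ⟨a, b, c, d, e⟩

theorem reticNum_eq (N : Net α) : N.reticNum = rr N.Adj := by
  unfold Net.reticNum rr
  simp only [indeg_eq]

theorem rr_zero_iff {V : Type} [Fintype V] (E : V → V → Prop) : rr E = 0 ↔ Tr E := by
  unfold rr Tr
  rw [Finset.sum_eq_zero_iff]
  simp only [Finset.mem_univ, true_imp_iff, Nat.sub_eq_zero_iff_le]
  simp only [ncard_le_one_iff' (fun u => E u _)]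
  constructor
  · intro h u u' v; exact h v u u'
  · intro h v u u'; exact h u u' v

theorem isPhyloTree_iff (X : Finset α) (N : Net α) :
    IsPhyloTree X N ↔ PN X N.Adj N.label ∧ Tr N.Adj := by
  unfold IsPhyloTree
  rw [isPhyloNet_iff, reticNum_eq, rr_zero_iff]

theorem clus_eq (N : Net α) (v : Fin N.n) : (N.clusterBelow v : Set α) = clus N.Adj N.label v := by
  ext a
  simp [Net.clusterBelow, clus, Net.Reaches, isLeaf_iff, and_assoc]

theorem disp_of_emb {N T : Net α} {φ Q} (h : Emb N.Adj N.label T.Adj T.label φ Q) :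
    Displays N T := by
  refine ⟨φ, h.inj, ?_, fun e => φ e.1 :: (Q e.1 e.2 ++ [φ e.2]), ?_, ?_, ?_⟩
  · intro v hv
    rw [isLeaf_iff] at hv ⊢
    exact h.leaf v hv
  · intro e he
    refine ⟨by simp, ?_, h.path _ _ he, by simp⟩
    show (φ e.1 :: (Q e.1 e.2 ++ [φ e.2])).getLast? = _
    rw [← List.cons_append, List.getLast?_append]; simp
  · intro e he w hw
    simp [internals] at hw
    rintro ⟨t, ht⟩
    exact h.avoid _ _ he w hw t ht
  · intro e he f hf hef w hw
    simp [internals] at hw ⊢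
    exact h.disj _ _ _ _ he hf hef w hw

theorem emb_of_disp {N T : Net α} (h : Displays N T) :
    ∃ φ Q, Emb N.Adj N.label T.Adj T.label φ Q := by
  obtain ⟨φ, inj, lf, P, h1, h2, h3⟩ := h
  refine ⟨φ, fun u v => internals (P (u, v)), inj, ?_, ?_, ?_, ?_⟩
  · intro v hv
    rw [← isLeaf_iff] at hv ⊢
    exact lf v hv
  · intro u v huv
    obtain ⟨a, b, c, d⟩ := h1 (u, v) huv
    have : φ u :: (internals (P (u, v)) ++ [φ v]) = P (u, v) := by
      generalize P (u, v) = p at a b d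
      rcases p with _ | ⟨x, p⟩
      · simp at a
      · rcases List.eq_nil_or_concat p with rfl | ⟨q, y, rfl⟩
        · simp at d
        · simp only [List.concat_eq_append] at *
          rw [← List.cons_append, List.getLast?_append] at b
          simp [internals] at a b ⊢
          exact ⟨a.symm, b.symm⟩
    simp only [this]
    exact c
  · intro u v huv w hw t ht
    exact h2 (u, v) huv w hw ⟨t, ht⟩
  · intro u v u' v' h h' hne w hw
    exact h3 (u, v) h (u', v') h' hne w hw

noncomputable def mk (V : Type) [Fintype V] (E : V → V → Prop) (l : V → α) : Net α where
  n := Fintype.card V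
  E := Finset.univ.filter fun p => E ((Fintype.equivFin V).symm p.1) ((Fintype.equivFin V).symm p.2)
  label := fun a => l ((Fintype.equivFin V).symm a)

section
variable {V V' : Type} [Fintype V] [Fintype V'] (E : V → V → Prop) (l : V → α)
  (E' : V' → V' → Prop) (l' : V' → α)

noncomputable def en : V ≃ Fin (mk V E l).n := Fintype.equivFin V

theorem mk_adj (a b) : (mk V E l).Adj a b ↔
    E ((en E l).symm a) ((en E l).symm b) := by
  unfold Net.Adj
  exact (Finset.mem_filter).trans ⟨fun h => h.2, fun h => ⟨Finset.mem_univ _, h⟩⟩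

theorem mk_label (a) : (mk V E l).label a = l ((en E l).symm a) := rfl

theorem mk_Lf (a) : Lf (mk V E l).Adj a ↔ Lf E ((en E l).symm a) := by
  unfold Lf
  simp only [mk_adj]
  exact (en E l).symm.forall_congr_left.trans (by simp)

theorem mk_Rt (a) : Rt (mk V E l).Adj a ↔ Rt E ((en E l).symm a) := by
  unfold Rt
  simp only [mk_adj]
  exact (en E l).symm.forall_congr_left.trans (by simp)

theorem mk_exu (P : V → Prop) : (∃! a, P ((en E l).symm a)) ↔ ∃! v, P v :=
  (en E l).symm.existsUnique_congr (by simp)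

theorem mk_PN {X : Finset α} (h : PN X E l) : PN X (mk V E l).Adj (mk V E l).label := by
  refine ⟨?_, ?_, ?_, ?_, ?_⟩
  · intro v hv
    refine h.acyc ((en E l).symm v) ?_
    exact hv.lift _ (fun a b hab => (mk_adj E l a b).1 hab)
  · simp only [mk_Rt]
    exact (mk_exu E l _).2 h.root
  · intro v
    simp only [mk_adj]
    have := h.nosup ((en E l).symm v)
    rwa [← mk_exu E l, ← mk_exu E l] at this
  · intro v hv u u' a b
    rw [mk_Lf] at hv
    rw [mk_adj] at a b
    exact (en E l).symm.injective (h.leafin _ hv _ _ a b)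
  · have : {v | Lf (mk V E l).Adj v} = (en E l).symm ⁻¹' {v | Lf E v} := by
      ext v; exact mk_Lf E l v
    rw [this]
    refine h.bij.comp (t := {v | Lf E v}) (f := (en E l).symm) ?_
    refine ⟨fun v hv => hv, (en E l).symm.injective.injOn, ?_⟩
    intro v hv
    exact ⟨en E l v, by simpa using hv, by simp⟩

theorem mk_Tr (h : Tr E) : Tr (mk V E l).Adj := by
  intro u u' v a b
  rw [mk_adj] at a b
  exact (en E l).symm.injective (h _ _ _ a b)

theorem mk_rr : rr (mk V E l).Adj = rr E := by
  unfold rr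
  refine Fintype.sum_equiv (en E l).symm _ _ ?_
  intro v
  congr 1
  refine Set.ncard_congr (fun a _ => (en E l).symm a) ?_ ?_ ?_
  · intro a ha; exact (mk_adj E l _ _).1 ha
  · intro a b _ _ hab; simpa using hab
  · intro b hb
    exact ⟨en E l b, (mk_adj E l _ _).2 (by simpa using hb), by simp⟩

theorem mk_reach (a b) : Relation.ReflTransGen (mk V E l).Adj a b ↔
    Relation.ReflTransGen E ((en E l).symm a) ((en E l).symm b) := by
  constructor
  · intro h
    exact h.lift _ (fun a b hab => (mk_adj E l a b).1 hab)
  · intro h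
    have := h.lift (p := (mk V E l).Adj) (en E l)
      (fun a b hab => (mk_adj E l _ _).2 (by simpa using hab))
    simpa [Function.onFun] using this

theorem mk_clus (a) : clus (mk V E l).Adj (mk V E l).label a
    = clus E l ((en E l).symm a) := by
  unfold clus
  ext x
  simp only [mk_reach, mk_Lf, Set.mem_ofPred_eq]
  constructor
  · rintro ⟨w, h1, h2, h3⟩
    exact ⟨_, h1, h2, h3⟩
  · rintro ⟨w, h1, h2, h3⟩
    exact ⟨en E l w, by simpa using h1, by simpa using h2, by simpa [mk_label] using h3⟩

theorem mk_Emb {φ Q} (h : Emb E l E' l' φ Q) :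
    ∃ φ' Q', Emb (mk V E l).Adj (mk V E l).label (mk V' E' l').Adj (mk V' E' l').label φ' Q' := by
  let e := en E l
  let e' := en E' l'
  refine ⟨fun a => e (φ (e'.symm a)), fun a b => (Q (e'.symm a) (e'.symm b)).map e, ?_, ?_, ?_, ?_, ?_⟩
  · intro a b hab
    simpa using h.inj (e.injective hab)
  · intro v hv
    rw [mk_Lf] at hv ⊢
    have := h.leaf _ hv
    simpa [mk_label, e, e'] using this
  · intro u v huv
    rw [mk_adj] at huv
    have := h.path _ _ huv
    have h2 : List.IsChain (mk V E l).Adj ((φ (e'.symm u) :: (Q (e'.symm u) (e'.symm v) ++ [φ (e'.symm v)])).map e) := by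
      rw [List.isChain_map]
      refine this.imp ?_
      intro a b hab
      exact (mk_adj E l _ _).2 (by simpa [e] using hab)
    simpa using h2
  · intro u v huv w hw t ht
    rw [mk_adj] at huv
    simp only [List.mem_map] at hw
    obtain ⟨x, hx, rfl⟩ := hw
    exact h.avoid _ _ huv x hx (e'.symm t) (e.injective ht)
  · intro u v u' v' h1 h2 hne w hw hw'
    rw [mk_adj] at h1 h2
    simp only [List.mem_map] at hw hw'
    obtain ⟨x, hx, rfl⟩ := hw
    obtain ⟨y, hy, hxy⟩ := hw'
    obtain rfl := e.injective hxy
    refine h.disj _ _ _ _ h1 h2 ?_ _ hx hy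
    intro hh
    apply hne
    simpa using hh

theorem rep_mk {X C : Finset α} (hP : PN X E' l') (hT : Tr E') {φ Q} (h : Emb E l E' l' φ Q)
    {u v} (huv : E' u v) (hC : clus E' l' v = C) : RepresentsCluster X (mk V E l) C := by
  obtain ⟨φ', Q', h'⟩ := mk_Emb E l E' l' h
  refine ⟨mk V' E' l', ?_, disp_of_emb h', (en E' l' u, en E' l' v), ?_, ?_⟩
  · rw [isPhyloTree_iff]; exact ⟨mk_PN _ _ hP, mk_Tr _ _ hT⟩
  · exact (mk_adj E' l' _ _).2 (by simpa using huv)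
  · have := clus_eq (mk V' E' l') (en E' l' v)
    rw [mk_clus] at this
    simp only [Equiv.symm_apply_apply, hC] at this
    exact_mod_cast this

end

end Transfer
section Comb

open Relation

variable {V W V' W' : Type}

theorem PN.wf [Finite V] {X : Finset α} {E : V → V → Prop} {l : V → α} (h : PN X E l) :
    WellFounded (TransGen E) := by
  haveI : Std.Irrefl (TransGen E) := ⟨h.acyc⟩
  exact Finite.wellFounded_of_trans_of_irrefl (TransGen E)

theorem PN.reach [Finite V] {X : Finset α} {E : V → V → Prop} {l : V → α} (h : PN X E l)
    {ρ : V} (hρ : Rt E ρ) (v : V) : ReflTransGen E ρ v := by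
  induction v using h.wf.induction with
  | _ v ih =>
    by_cases hv : Rt E v
    · rw [h.root.unique hρ hv]
    · unfold Rt at hv
      push Not at hv
      obtain ⟨u, hu⟩ := hv
      exact (ih u (TransGen.single hu)).tail hu

theorem reach_leaf {E : V → V → Prop} {v w : V} (hv : Lf E v) (h : ReflTransGen E v w) : w = v := by
  rcases h.cases_head with h | ⟨c, hc, _⟩
  · exact h.symm
  · exact absurd hc (hv c)

theorem reach_root {E : V → V → Prop} {v w : V} (hv : Rt E w) (h : ReflTransGen E v w) : w = v := by
  rcases h.cases_tail with h | ⟨c, _, hc⟩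
  · exact h
  · exact absurd hc (hv c)

theorem clus_leaf {E : V → V → Prop} {l : V → α} {v : V} (hv : Lf E v) : clus E l v = {l v} := by
  ext a
  constructor
  · rintro ⟨w, h1, h2, h3⟩
    rw [reach_leaf hv h1] at h3
    exact h3.symm
  · rintro rfl
    exact ⟨v, .refl, hv, rfl⟩

theorem clus_sub {X : Finset α} {E : V → V → Prop} {l : V → α} (h : PN X E l) (v : V) :
    clus E l v ⊆ (X : Set α) := by
  rintro a ⟨w, h1, h2, rfl⟩
  exact h.bij.mapsTo h2

theorem clus_root [Finite V] {X : Finset α} {E : V → V → Prop} {l : V → α} (h : PN X E l)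
    {ρ : V} (hρ : Rt E ρ) : clus E l ρ = (X : Set α) := by
  apply (clus_sub h ρ).antisymm
  intro a ha
  obtain ⟨w, hw, rfl⟩ := h.bij.surjOn ha
  exact ⟨w, h.reach hρ w, hw, rfl⟩

theorem clus_nonempty [Finite V] {X : Finset α} {E : V → V → Prop} {l : V → α} (h : PN X E l)
    (v : V) : (clus E l v).Nonempty := by
  have hwf : WellFounded (Function.swap (TransGen E)) := by
    haveI : Std.Irrefl (Function.swap (TransGen E)) := ⟨h.acyc⟩
    haveI : IsTrans V (Function.swap (TransGen E)) := ⟨fun a b c h1 h2 => h2.trans h1⟩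
    exact Finite.wellFounded_of_trans_of_irrefl _
  induction v using hwf.induction with
  | _ v ih =>
    by_cases hv : Lf E v
    · rw [clus_leaf hv]; simp
    · unfold Lf at hv
      push Not at hv
      obtain ⟨u, hu⟩ := hv
      obtain ⟨a, w, h1, h2, h3⟩ := ih u (TransGen.single hu)
      exact ⟨a, w, h1.head hu, h2, h3⟩

theorem clus_mono {E : V → V → Prop} {l : V → α} {u v : V} (h : ReflTransGen E u v) :
    clus E l v ⊆ clus E l u := by
  rintro a ⟨w, h1, h2, h3⟩
  exact ⟨w, h.trans h1, h2, h3⟩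

theorem clus_compat {X : Finset α} {E : V → V → Prop} {l : V → α} (h : PN X E l) (ht : Tr E)
    (u v : V) {a : α} (hu : a ∈ clus E l u) (hv : a ∈ clus E l v) :
    clus E l u ⊆ clus E l v ∨ clus E l v ⊆ clus E l u := by
  obtain ⟨w, h1, h2, rfl⟩ := hu
  obtain ⟨w', h1', h2', h3⟩ := hv
  obtain rfl := h.bij.injOn h2' h2 h3
  have U : Relator.RightUnique (Function.swap E) := fun a b c h1 h2 => ht _ _ _ h1 h2
  rw [← reflTransGen_swap] at h1 h1'
  rcases ReflTransGen.total_of_right_unique U h1 h1' with h | h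
  · rw [reflTransGen_swap] at h
    exact Or.inl (clus_mono h)
  · rw [reflTransGen_swap] at h
    exact Or.inr (clus_mono h)

/-! adding a root -/

def AR (F : W → W → Prop) (y0 : W) : Option W → Option W → Prop
  | none, some y => y = y0
  | some y, some z => F y z
  | none, none => False
  | some _, none => False

def ARl (l : W → α) (y0 : W) : Option W → α
  | none => l y0
  | some y => l y

section
variable {F : W → W → Prop} {y0 : W} {l : W → α}

theorem AR_trans {a b : Option W} (h : TransGen (AR F y0) a b) :
    match a, b with
    | some a, some b => TransGen F a b
    | none, some _ => True
    | _, none => False := by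
  induction h with
  | single h => 
    rename_i b
    rcases a with _ | a <;> rcases b with _ | b
    · exact h
    · trivial
    · exact h
    · exact TransGen.single h
  | tail h1 h2 ih =>
    rename_i b c
    rcases a with _ | a <;> rcases b with _ | b <;> rcases c with _ | c <;> try trivial
    exact TransGen.tail ih h2

theorem AR_reach {a b : W} : ReflTransGen (AR F y0) (some a) (some b) ↔ ReflTransGen F a b := by
  constructor
  · intro h
    rcases reflTransGen_iff_eq_or_transGen.1 h with h | h
    · simp at h; rw [h]
    · exact (AR_trans h).to_reflTransGen
  · intro h
    exact ReflTransGen.lift (p := AR F y0) some (fun a b h => h) _ _ h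

theorem AR_Lf {a : W} : Lf (AR F y0) (some a) ↔ Lf F a := by
  unfold Lf
  simp [Option.forall, AR]

theorem AR_Lf_none : ¬ Lf (AR F y0) none := by
  unfold Lf
  simp [Option.forall, AR]

theorem AR_Rt_none : Rt (AR F y0) none := by
  unfold Rt
  simp [Option.forall, AR]

theorem AR_clus (a : W) : clus (AR F y0) (ARl l y0) (some a) = clus F l a := by
  ext x
  simp only [clus, Set.mem_ofPred_eq, Option.exists, AR_reach, AR_Lf, AR_Lf_none, ARl]
  simp

theorem AR_Tr (h : Tr F) (hr : Rt F y0) : Tr (AR F y0) := by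
  intro u u' v a b
  rcases v with _ | v
  · rcases u with _ | u <;> exact absurd a (by simp [AR])
  rcases u with _ | u <;> rcases u' with _ | u' <;> simp only [AR] at a b
  · rfl
  · subst a; exact absurd b (hr _)
  · subst b; exact absurd a (hr _)
  · rw [h _ _ _ a b]

theorem AR_PN {X : Finset α} (h : PN X F l) (hr : Rt F y0) (hc : ¬ ∃! w, F y0 w) :
    PN X (AR F y0) (ARl l y0) := by
  refine ⟨?_, ⟨none, AR_Rt_none, ?_⟩, ?_, ?_, ?_⟩
  · rintro (_ | v) hv
    · exact AR_trans hv
    · exact h.acyc v (AR_trans hv)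
  · rintro (_ | y) hy
    · rfl
    · exfalso
      have : Rt F y := fun u => hy (some u)
      have h2 := h.root.unique hr this
      exact hy none (by simp [AR, h2])
  · rintro (_ | v) ⟨⟨u, hu, hu'⟩, ⟨w, hw, hw'⟩⟩
    · exact AR_Rt_none u hu
    · rcases w with _ | w
      · simp [AR] at hw
      have hw1 : ∃! w, F v w := ⟨w, hw, fun z hz => by simpa using hw' (some z) hz⟩
      rcases u with _ | u
      · simp only [AR] at hu
        subst hu; exact hc hw1
      · refine h.nosup v ⟨⟨u, hu, fun z hz => by simpa using hu' (some z) hz⟩, hw1⟩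
  · rintro (_ | v) hv u u' a b
    · exact absurd hv AR_Lf_none
    · rw [AR_Lf] at hv
      rcases u with _ | u <;> rcases u' with _ | u' <;> simp only [AR] at a b
      · rfl
      · subst a; exact absurd b (hr _)
      · subst b; exact absurd a (hr _)
      · rw [h.leafin _ hv _ _ a b]
  · refine ⟨?_, ?_, ?_⟩
    · rintro (_ | v) hv
      · exact absurd hv AR_Lf_none
      · exact h.bij.mapsTo (AR_Lf.1 hv)
    · rintro (_ | v) hv (_ | w) hw hvw
      · rfl
      · exact absurd hv AR_Lf_none
      · exact absurd hw AR_Lf_none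
      · rw [h.bij.injOn (AR_Lf.1 hv) (AR_Lf.1 hw) hvw]
    · intro a ha
      obtain ⟨v, hv, rfl⟩ := h.bij.surjOn ha
      exact ⟨some v, AR_Lf.2 hv, rfl⟩

end

/-! hierarchy tree -/

theorem exists_hier (S : Finset α) (hS : S.Nonempty) (H : Set (Finset α))
    (hH : ∀ C ∈ H, C ⊆ S ∧ C.Nonempty) (hc : ∀ C ∈ H, ∀ D ∈ H, Compatible C D) :
    ∃ (W : Type) (_ : Fintype W) (F : W → W → Prop) (l : W → α) (y0 : W),
      PN S F l ∧ Tr F ∧ Rt F y0 ∧ (¬ ∃! w, F y0 w) ∧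
      ∀ C ∈ H, C ≠ S → ∃ u v, F u v ∧ clus F l v = C := by
  let P : Finset α → Prop := fun D => D = S ∨ (∃ a ∈ S, D = {a}) ∨ D ∈ H
  have hPs : ∀ D, P D → D ⊆ S ∧ D.Nonempty := by
    rintro D (rfl | ⟨a, ha, rfl⟩ | h)
    · exact ⟨subset_rfl, hS⟩
    · exact ⟨by simpa using ha, by simp⟩
    · exact hH D h
  have hPc : ∀ D, P D → ∀ D', P D' → ∀ a, a ∈ D → a ∈ D' → D ⊆ D' ∨ D' ⊆ D := by
    rintro D hD D' hD' a ha ha'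
    rcases hD with rfl | ⟨b, hb, rfl⟩ | h
    · exact Or.inr (hPs D' hD').1
    · left; simp at ha; subst ha; simpa using ha'
    · rcases hD' with rfl | ⟨b, hb, rfl⟩ | h'
      · exact Or.inl (hH D h).1
      · right; simp at ha'; subst ha'; simpa using ha
      · rcases hc D h D' h' with h | h | h
        · exfalso
          have : a ∈ D ∩ D' := by simp [ha, ha']
          rw [h] at this; simp at this
        · exact Or.inl h
        · exact Or.inr h
  let W := {D : Finset α // P D}
  haveI : Finite W := by
    refine Set.Finite.to_subtype (s := {D | P D}) ?_
    refine (S.powerset.finite_toSet).subset ?_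
    intro D hD
    simpa using (hPs D hD).1
  letI : Fintype W := Fintype.ofFinite W
  letI : LocallyFiniteOrder W := Fintype.toLocallyFiniteOrder
  let F : W → W → Prop := fun D D' => D' ⋖ D
  let l : W → α := fun D => (hPs D.1 D.2).2.choose
  have hl : ∀ D : W, l D ∈ D.1 := fun D => (hPs D.1 D.2).2.choose_spec
  let sg : ∀ a ∈ S, W := fun a ha => ⟨{a}, Or.inr (Or.inl ⟨a, ha, rfl⟩)⟩
  let y0 : W := ⟨S, Or.inl rfl⟩
  have htop : ∀ D : W, D ≤ y0 := fun D => (hPs D.1 D.2).1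
  have hlf : ∀ D : W, Lf F D ↔ ∃ a, D.1 = {a} := by
    intro D
    constructor
    · intro h
      refine ⟨l D, ?_⟩
      by_contra hne
      have hlt : sg (l D) ((hPs D.1 D.2).1 (hl D)) < D := by
        refine lt_of_le_of_ne ?_ ?_
        · show ({l D} : Finset α) ⊆ D.1
          simpa using hl D
        · intro hh; exact hne (congrArg Subtype.val hh).symm
      obtain ⟨x, _, hx⟩ := exists_le_covBy_of_lt hlt
      exact h x hx
    · rintro ⟨a, ha⟩ D' hD'
      have h1 : D'.1 ⊂ D.1 := hD'.lt
      rw [ha, Finset.ssubset_singleton_iff] at h1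
      exact (hPs D'.1 D'.2).2.ne_empty h1
  have hreach : ∀ D D' : W, ReflTransGen F D D' ↔ D' ≤ D := by
    intro D D'
    rw [le_iff_reflTransGen_covBy, ← reflTransGen_swap]
  have hTr : Tr F := by
    intro D D' B h1 h2
    have hB := hl B
    have a1 : B.1 ⊆ D.1 := h1.le
    have a2 : B.1 ⊆ D'.1 := h2.le
    rcases hPc D.1 D.2 D'.1 D'.2 _ (a1 hB) (a2 hB) with h | h
    · have : D ≤ D' := h
      by_contra hne
      exact h2.2 h1.lt (lt_of_le_of_ne this hne)
    · have : D' ≤ D := h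
      by_contra hne
      exact h1.2 h2.lt (lt_of_le_of_ne this (Ne.symm hne))
  have hnou : ∀ D : W, ¬ ∃! w, F D w := by
    rintro D ⟨B, hB, hu⟩
    have h1 : B.1 ⊂ D.1 := hB.lt
    obtain ⟨x, hx, hxB⟩ := Finset.exists_of_ssubset h1
    have hlt : sg x ((hPs D.1 D.2).1 hx) < D := by
      refine lt_of_le_of_ne ?_ ?_
      · show ({x} : Finset α) ⊆ D.1
        simpa using hx
      · intro hh
        have h2 : {x} = D.1 := congrArg Subtype.val hh
        rw [← h2, Finset.ssubset_singleton_iff] at h1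
        exact (hPs B.1 B.2).2.ne_empty h1
    obtain ⟨z, hz1, hz⟩ := exists_le_covBy_of_lt hlt
    have := hu z hz
    subst this
    have h3 : ({x} : Finset α) ⊆ z.1 := hz1
    exact hxB (h3 (by simp))
  have hclus : ∀ D : W, clus F l D = D.1 := by
    intro D
    ext a
    constructor
    · rintro ⟨B, h1, h2, rfl⟩
      rw [hreach] at h1
      exact (show B.1 ⊆ D.1 from h1) (hl B)
    · intro ha
      have haS := (hPs D.1 D.2).1 ha
      refine ⟨sg a haS, ?_, (hlf _).2 ⟨a, rfl⟩, ?_⟩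
      · rw [hreach]
        show ({a} : Finset α) ⊆ D.1
        simpa using ha
      · have := hl (sg a haS)
        simpa [sg] using this
  have hpar : ∀ D : W, D ≠ y0 → ∃ u, F u D := by
    intro D hD
    obtain ⟨x, hx, _⟩ := exists_covBy_le_of_lt (lt_of_le_of_ne (htop D) hD)
    exact ⟨x, hx⟩
  have hrt : Rt F y0 := fun u hu => not_lt_of_ge (htop u) hu.lt
  refine ⟨W, inferInstance, F, l, y0, ⟨?_, ⟨y0, hrt, ?_⟩, ?_, ?_, ?_⟩, hTr, hrt, hnou y0, ?_⟩
  · intro v hv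
    have : ∀ a b, TransGen F a b → b < a := by
      intro a b h
      induction h with
      | single h => exact h.lt
      | tail _ h ih => exact h.lt.trans ih
    exact lt_irrefl _ (this _ _ hv)
  · intro y hy
    by_contra hne
    obtain ⟨u, hu⟩ := hpar y hne
    exact hy u hu
  · rintro v ⟨_, h⟩; exact hnou v h
  · intro v _ u u' a b; exact hTr _ _ _ a b
  · refine ⟨?_, ?_, ?_⟩
    · intro D _
      exact (hPs D.1 D.2).1 (hl D)
    · intro D hD D' hD' h
      obtain ⟨a, ha⟩ := (hlf D).1 hD
      obtain ⟨b, hb⟩ := (hlf D').1 hD'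
      have h1 := hl D
      have h2 := hl D'
      rw [ha] at h1
      rw [hb] at h2
      simp at h1 h2
      apply Subtype.ext
      rw [ha, hb, ← h1, ← h2, h]
    · intro a ha
      refine ⟨sg a ha, (hlf _).2 ⟨a, rfl⟩, ?_⟩
      have := hl (sg a ha)
      simpa [sg] using this
  · intro C hC hne
    let D : W := ⟨C, Or.inr (Or.inr hC)⟩
    obtain ⟨u, hu⟩ := hpar D (fun h => hne (congrArg Subtype.val h))
    exact ⟨u, D, hu, hclus D⟩

end Comb
section Hang

open Relation

variable {V W V' W' : Type}

def att (E : V → V → Prop) (l : V → α) (A : Finset α) (R : V → Prop) (u : V) : Prop :=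
  (Lf E u ∧ l u ∈ A) ∨ R u

def HE (E : V → V → Prop) (l : V → α) (A : Finset α) (R : V → Prop) (F : W → W → Prop) (y0 : W) :
    V ⊕ (A ⊕ W) → V ⊕ (A ⊕ W) → Prop
  | .inl u, .inl v => E u v
  | .inl u, .inr (.inl a) => Lf E u ∧ l u = a
  | .inl u, .inr (.inr y) => y = y0 ∧ att E l A R u
  | .inr (.inl _), .inl _ => False
  | .inr (.inl _), .inr (.inl _) => False
  | .inr (.inl _), .inr (.inr _) => False
  | .inr (.inr _), .inl _ => False
  | .inr (.inr _), .inr (.inl _) => False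
  | .inr (.inr y), .inr (.inr z) => F y z

def HL (l : V → α) (A : Finset α) (l' : W → α) : V ⊕ (A ⊕ W) → α
  | .inl u => l u
  | .inr (.inl a) => a
  | .inr (.inr y) => l' y

section
variable {E : V → V → Prop} {l : V → α} {A : Finset α} {R : V → Prop} {F : W → W → Prop} {y0 : W}
  {l' : W → α} {X S : Finset α}

theorem HE_trans {a b} (h : TransGen (HE E l A R F y0) a b) :
    match a, b with
    | .inl a, .inl b => TransGen E a b
    | .inl u, .inr (.inl a) => ∃ w, ReflTransGen E u w ∧ Lf E w ∧ l w = a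
    | .inl u, .inr (.inr _) => ∃ w, ReflTransGen E u w ∧ att E l A R w
    | .inr (.inr a), .inr (.inr b) => TransGen F a b
    | _, _ => False := by
  induction h with
  | single h =>
    rename_i b
    rcases a with a | a | a <;> rcases b with b | b | b <;> try trivial
    · exact TransGen.single h
    · exact ⟨a, .refl, h⟩
    · exact ⟨a, .refl, h.2⟩
    · exact TransGen.single h
  | tail h1 h2 ih =>
    rename_i b c
    rcases a with a | a | a <;> rcases b with b | b | b <;> rcases c with c | c | c <;> try trivial
    · exact TransGen.tail ih h2
    · exact ⟨b, TransGen.to_reflTransGen ih, h2⟩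
    · exact ⟨b, TransGen.to_reflTransGen ih, h2.2⟩
    · exact TransGen.tail ih h2

theorem HE_reach_ll {a b : V} :
    ReflTransGen (HE E l A R F y0) (.inl a) (.inl b) ↔ ReflTransGen E a b := by
  constructor
  · intro h
    rcases reflTransGen_iff_eq_or_transGen.1 h with h | h
    · simp at h; rw [h]
    · exact (HE_trans h).to_reflTransGen
  · intro h
    exact ReflTransGen.lift (p := HE E l A R F y0) Sum.inl (fun a b h => h) _ _ h

theorem HE_reach_rr {a b : W} :
    ReflTransGen (HE E l A R F y0) (.inr (.inr a)) (.inr (.inr b)) ↔ ReflTransGen F a b := by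
  constructor
  · intro h
    rcases reflTransGen_iff_eq_or_transGen.1 h with h | h
    · simp at h; rw [h]
    · exact (HE_trans h).to_reflTransGen
  · intro h
    exact ReflTransGen.lift (p := HE E l A R F y0) (fun x => Sum.inr (Sum.inr x)) (fun a b h => h) _ _ h

theorem HE_Lf_l {v : V} : Lf (HE E l A R F y0) (.inl v) ↔ Lf E v ∧ l v ∉ A ∧ ¬ R v := by
  constructor
  · intro h
    have h1 : Lf E v := fun w hw => h (.inl w) hw
    have h2 : ¬ att E l A R v := fun hh => h (.inr (.inr y0)) ⟨rfl, hh⟩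
    unfold att at h2
    push Not at h2
    exact ⟨h1, h2.1 h1, h2.2⟩
  · rintro ⟨h1, h2, h3⟩ (w | w | w) hw
    · exact h1 w hw
    · exact h2 (hw.2 ▸ w.2)
    · rcases hw.2 with h | h
      · exact h2 h.2
      · exact h3 h

theorem HE_Lf_a {a : A} : Lf (HE E l A R F y0) (.inr (.inl a)) := by
  rintro (w | w | w) hw <;> exact hw

theorem HE_Lf_r {y : W} : Lf (HE E l A R F y0) (.inr (.inr y)) ↔ Lf F y := by
  constructor
  · intro h w hw
    exact h (.inr (.inr w)) hw
  · rintro h (w | w | w) hw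
    · exact hw
    · exact hw
    · exact h w hw

theorem HE_Rt_l {v : V} : Rt (HE E l A R F y0) (.inl v) ↔ Rt E v := by
  constructor
  · intro h w hw
    exact h (.inl w) hw
  · rintro h (w | w | w) hw
    · exact h w hw
    · exact hw
    · exact hw

theorem HE_Tr (hE : PN X E l) (hT : Tr E) (hF : Tr F) (hy : Rt F y0)
    (ha : ∀ u u', att E l A R u → att E l A R u' → u = u') : Tr (HE E l A R F y0) := by
  rintro (u | u | u) (u' | u' | u') (v | v | v) a b <;> try trivial
  · rw [hT _ _ _ a b]
  · rw [hE.bij.injOn a.1 b.1 (a.2.trans b.2.symm)]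
  · rw [ha _ _ a.2 b.2]
  · obtain ⟨rfl, _⟩ := a
    exact absurd b (hy _)
  · obtain ⟨rfl, _⟩ := b
    exact absurd a (hy _)
  · rw [hF _ _ _ a b]

theorem HE_PN (hE : PN X E l) (hF : PN S F l') (hy : Rt F y0) (hA : A ⊆ X) (hXS : Disjoint X S)
    (hR : ∀ v, R v → Rt E v ∧ ¬ Lf E v) (hne : ∃ u, att E l A R u)
    (h1 : ¬ ((∃! u, att E l A R u) ∧ ∃! w, F y0 w))
    (h2 : Lf F y0 → ∀ u u', att E l A R u → att E l A R u' → u = u') :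
    PN (X ∪ S) (HE E l A R F y0) (HL l A l') := by
  refine ⟨?_, ?_, ?_, ?_, ?_⟩
  · rintro (v | v | v) hv
    · exact hE.acyc v (HE_trans hv)
    · exact HE_trans hv
    · exact hF.acyc v (HE_trans hv)
  · obtain ⟨ρ, hρ, hu⟩ := hE.root
    refine ⟨.inl ρ, HE_Rt_l.2 hρ, ?_⟩
    rintro (v | v | v) hv
    · rw [hu v (HE_Rt_l.1 hv)]
    · exfalso
      obtain ⟨w, hw, hw'⟩ := hE.bij.surjOn (hA v.2)
      exact hv (.inl w) ⟨hw, hw'⟩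
    · exfalso
      have : Rt F v := fun u hu => hv (.inr (.inr u)) hu
      obtain ⟨u, hu⟩ := hne
      exact hv (.inl u) ⟨hF.root.unique this hy, hu⟩
  · rintro (v | v | v) ⟨⟨u, hu, hu'⟩, ⟨w, hw, hw'⟩⟩
    · rcases u with u | u | u <;> try trivial
      have hp : ∃! u, E u v := ⟨u, hu, fun z hz => by simpa using hu' (.inl z) hz⟩
      have hnR : ¬ R v := fun h => (hR v h).1 u hu
      rcases w with w | w | w
      · exact hE.nosup v ⟨hp, ⟨w, hw, fun z hz => by simpa using hw' (.inl z) hz⟩⟩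
      · have := hw' (.inr (.inr y0)) ⟨rfl, Or.inl ⟨hw.1, hw.2 ▸ w.2⟩⟩
        simp at this
      · rcases hw.2 with h | h
        · have := hw' (.inr (.inl ⟨l v, h.2⟩)) ⟨h.1, rfl⟩
          simp at this
        · exact hnR h
    · exact HE_Lf_a _ hw
    · rcases w with w | w | w <;> try trivial
      have hc : ∃! w, F v w := ⟨w, hw, fun z hz => by simpa using hw' (.inr (.inr z)) hz⟩
      rcases u with u | u | u <;> try trivial
      · obtain ⟨rfl, hu⟩ := hu
        exact h1 ⟨⟨u, hu, fun z hz => by simpa using hu' (.inl z) ⟨rfl, hz⟩⟩, hc⟩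
      · exact hF.nosup v ⟨⟨u, hu, fun z hz => by simpa using hu' (.inr (.inr z)) hz⟩, hc⟩
  · rintro (v | v | v) hv (u | u | u) (u' | u' | u') a b <;> try trivial
    · rw [hE.leafin _ (HE_Lf_l.1 hv).1 _ _ a b]
    · rw [hE.bij.injOn a.1 b.1 (a.2.trans b.2.symm)]
    · obtain ⟨rfl, a⟩ := a
      rw [h2 (HE_Lf_r.1 hv) _ _ a b.2]
    · obtain ⟨rfl, _⟩ := a
      exact absurd b (hy _)
    · obtain ⟨rfl, _⟩ := b
      exact absurd a (hy _)
    · rw [hF.leafin _ (HE_Lf_r.1 hv) _ _ a b]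
  · have hm : ∀ v, Lf E v → l v ∈ X := fun v hv => hE.bij.mapsTo hv
    have hm' : ∀ v, Lf F v → l' v ∈ S := fun v hv => hF.bij.mapsTo hv
    have hd : ∀ a, a ∈ X → a ∈ S → False := fun a h h' => Finset.disjoint_left.1 hXS h h'
    refine ⟨?_, ?_, ?_⟩
    · rintro (v | v | v) hv
      · simpa [HL] using Or.inl (hm v (HE_Lf_l.1 hv).1)
      · simpa [HL] using Or.inl (hA v.2)
      · simpa [HL] using Or.inr (hm' v (HE_Lf_r.1 hv))
    · rintro (v | v | v) hv (w | w | w) hw hvw <;> simp only [HL] at hvw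
      · rw [hE.bij.injOn (HE_Lf_l.1 hv).1 (HE_Lf_l.1 hw).1 hvw]
      · exact absurd w.2 (hvw ▸ (HE_Lf_l.1 hv).2.1)
      · exact absurd (hm' w (HE_Lf_r.1 hw)) (hvw ▸ hd _ (hm v (HE_Lf_l.1 hv).1))
      · exact absurd v.2 (hvw ▸ (HE_Lf_l.1 hw).2.1)
      · rw [Subtype.ext hvw]
      · exact absurd (hm' w (HE_Lf_r.1 hw)) (hvw ▸ hd _ (hA v.2))
      · exact absurd (hm' v (HE_Lf_r.1 hv)) (hvw ▸ hd _ (hm w (HE_Lf_l.1 hw).1))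
      · exact absurd (hm' v (HE_Lf_r.1 hv)) (hvw ▸ hd _ (hA w.2))
      · rw [hF.bij.injOn (HE_Lf_r.1 hv) (HE_Lf_r.1 hw) hvw]
    · intro a ha
      by_cases haA : a ∈ A
      · exact ⟨.inr (.inl ⟨a, haA⟩), HE_Lf_a, rfl⟩
      · have ha' : a ∈ X ∨ a ∈ S := by simpa using ha
        rcases ha' with ha | ha
        · obtain ⟨w, hw, rfl⟩ := hE.bij.surjOn ha
          exact ⟨.inl w, HE_Lf_l.2 ⟨hw, haA, fun h => (hR w h).2 hw⟩, rfl⟩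
        · obtain ⟨w, hw, rfl⟩ := hF.bij.surjOn ha
          exact ⟨.inr (.inr w), HE_Lf_r.2 hw, rfl⟩

theorem HE_clus_r (y : W) : clus (HE E l A R F y0) (HL l A l') (.inr (.inr y)) = clus F l' y := by
  ext a
  constructor
  · rintro ⟨w, h1, h2, h3⟩
    rcases w with w | w | w
    · rcases reflTransGen_iff_eq_or_transGen.1 h1 with h | h
      · simp at h
      · exact (HE_trans h).elim
    · rcases reflTransGen_iff_eq_or_transGen.1 h1 with h | h
      · simp at h
      · exact (HE_trans h).elim
    · exact ⟨w, HE_reach_rr.1 h1, HE_Lf_r.1 h2, h3⟩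
  · rintro ⟨w, h1, h2, h3⟩
    exact ⟨_, HE_reach_rr.2 h1, HE_Lf_r.2 h2, h3⟩

theorem HE_clus_l [Finite W] (hF : PN S F l') (hy : Rt F y0)
    (hR : ∀ v, R v → Rt E v ∧ ¬ Lf E v) (v : V) :
    clus (HE E l A R F y0) (HL l A l') (.inl v) =
      clus E l v ∪ {a | a ∈ S ∧ ∃ u, ReflTransGen E v u ∧ att E l A R u} := by
  ext a
  constructor
  · rintro ⟨w, h1, h2, rfl⟩
    rcases w with w | w | w
    · exact Or.inl ⟨w, HE_reach_ll.1 h1, (HE_Lf_l.1 h2).1, rfl⟩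
    · rcases reflTransGen_iff_eq_or_transGen.1 h1 with h | h
      · simp at h
      · exact Or.inl (HE_trans h)
    · rcases reflTransGen_iff_eq_or_transGen.1 h1 with h | h
      · simp at h
      · exact Or.inr ⟨hF.bij.mapsTo (HE_Lf_r.1 h2), HE_trans h⟩
  · rintro (⟨w, h1, h2, rfl⟩ | ⟨ha, u, h1, h2⟩)
    · by_cases hA : l w ∈ A
      · exact ⟨.inr (.inl ⟨l w, hA⟩), (HE_reach_ll.2 h1).tail ⟨h2, rfl⟩, HE_Lf_a, rfl⟩
      · exact ⟨.inl w, HE_reach_ll.2 h1, HE_Lf_l.2 ⟨h2, hA, fun h => (hR w h).2 h2⟩, rfl⟩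
    · obtain ⟨w, hw, rfl⟩ := hF.bij.surjOn ha
      have h3 : HE E l A R F y0 (.inl u) (.inr (.inr y0)) := ⟨rfl, h2⟩
      exact ⟨.inr (.inr w), ((HE_reach_ll.2 h1).tail h3).trans (HE_reach_rr.2 (hF.reach hy w)),
        HE_Lf_r.2 hw, rfl⟩

theorem HE_rr [Fintype V] [Fintype W] (hE : PN X E l) (hF : Tr F) (hy : Rt F y0) :
    rr (HE E l A R F y0) ≤ rr E + (({u | att E l A R u} : Set V).ncard - 1) := by
  unfold rr
  rw [Fintype.sum_sum_type, Fintype.sum_sum_type]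
  have e1 : ∀ v, ({u | HE E l A R F y0 u (.inl v)} : Set (V ⊕ (A ⊕ W))).ncard =
      ({u | E u v} : Set V).ncard := by
    intro v
    rw [← Set.ncard_image_of_injective ({u | E u v} : Set V) (Sum.inl_injective (β := A ⊕ W))]
    congr 1
    ext (u | u | u)
    · simp [HE]
    · simp [HE]
    · simp [HE]
  have e2 : ∀ a, ({u | HE E l A R F y0 u (.inr (.inl a))} : Set (V ⊕ (A ⊕ W))).ncard - 1 = 0 := by
    intro a
    rw [Nat.sub_eq_zero_iff_le, ncard_le_one_iff']
    rintro (u | u | u) (u' | u' | u') h h' <;> try trivial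
    rw [hE.bij.injOn h.1 h'.1 (h.2.trans h'.2.symm)]
  have e3 : ∀ y, ({u | HE E l A R F y0 u (.inr (.inr y))} : Set (V ⊕ (A ⊕ W))).ncard - 1 ≤
      if y = y0 then (({u | att E l A R u} : Set V).ncard - 1) else 0 := by
    intro y
    split_ifs with h
    · subst h
      apply Nat.sub_le_sub_right
      apply le_of_eq
      rw [← Set.ncard_image_of_injective ({u | att E l A R u} : Set V)
        (Sum.inl_injective (β := A ⊕ W))]
      congr 1
      ext (u | u | u)
      · simp [HE]
      · simp [HE]
      · simp [HE, hy u]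
    · rw [Nat.le_zero, Nat.sub_eq_zero_iff_le, ncard_le_one_iff']
      rintro (u | u | u) (u' | u' | u') a b <;> try trivial
      · exact absurd a.1 h
      · exact absurd a.1 h
      · exact absurd b.1 h
      · rw [hF _ _ _ a b]
  simp only [e1, e2, Finset.sum_const_zero, zero_add]
  apply Nat.add_le_add_left
  refine (Finset.sum_le_sum (fun y _ => e3 y)).trans ?_
  simp

end

/-! the embedding -/

theorem HE_Emb {E : V → V → Prop} {l : V → α} {A : Finset α} {R : V → Prop}
    {E' : V' → V' → Prop} {l' : V' → α} {B : Finset α} {R' : V' → Prop}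
    {F : W → W → Prop} {lF : W → α} {y0 : W} {φ : V' → V} {Q : V' → V' → List V} {X : Finset α}
    (h : Emb E l E' l' φ Q) (hP : PN X E' l') (hT : Tr E')
    (hBA : B ⊆ A) (hRR : ∀ t, R' t → R (φ t)) (hR : ∀ v, R v → ¬ Lf E v)
    (ha : ∀ u u', att E' l' B R' u → att E' l' B R' u' → u = u') :
    ∃ φ' Q', Emb (HE E l A R (AR F y0) none) (HL l A (ARl lF y0))
      (HE E' l' B R' F y0) (HL l' B lF) φ' Q' := by
  let c : V' → Prop := fun t => Lf E' t ∧ l' t ∈ A ∧ l' t ∉ B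
  let φ' : V' ⊕ (B ⊕ W) → V ⊕ (A ⊕ Option W) := fun x => match x with
    | .inl t => if hc : c t then .inr (.inl ⟨l' t, hc.2.1⟩) else .inl (φ t)
    | .inr (.inl b) => .inr (.inl ⟨b, hBA b.2⟩)
    | .inr (.inr y) => .inr (.inr (some y))
  let Q' : V' ⊕ (B ⊕ W) → V' ⊕ (B ⊕ W) → List (V ⊕ (A ⊕ Option W)) := fun x y => match x, y with
    | .inl s, .inl t => (Q s t).map .inl ++ (if c t then [.inl (φ t)] else [])
    | .inl _, .inr (.inr _) => [.inr (.inr none)]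
    | _, _ => []
  have p1 : ∀ t, c t → ∃ h, φ' (.inl t) = .inr (.inl ⟨l' t, h⟩) := by
    intro t ht; exact ⟨ht.2.1, by simp only [φ', dif_pos ht]⟩
  have p2 : ∀ t, ¬ c t → φ' (.inl t) = .inl (φ t) := by
    intro t ht; simp only [φ', dif_neg ht]
  have p3 : ∀ s t, E' s t → φ' (.inl s) = .inl (φ s) := fun s t hst => p2 s (fun hc => hc.1 t hst)
  have p4 : ∀ x v, φ' x = .inl v → ∃ t, x = .inl t ∧ ¬ c t ∧ φ t = v := by
    rintro (t | t | t) v hv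
    · by_cases hc : c t
      · obtain ⟨_, h⟩ := p1 t hc
        rw [h] at hv; simp at hv
      · rw [p2 t hc] at hv
        exact ⟨t, rfl, hc, by simpa using hv⟩
    · simp [φ'] at hv
    · simp [φ'] at hv
  have lfA : ∀ t, Lf E' t → Lf E (φ t) ∧ l (φ t) = l' t := h.leaf
  have q1 : ∀ s t w, w ∈ Q' (.inl s) (.inl t) →
      (∃ v ∈ Q s t, w = .inl v) ∨ (c t ∧ w = .inl (φ t)) := by
    intro s t w hw
    simp only [Q', List.mem_append, List.mem_map] at hw
    rcases hw with ⟨v, hv, rfl⟩ | hw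
    · exact Or.inl ⟨v, hv, rfl⟩
    · split_ifs at hw with hc
      · exact Or.inr ⟨hc, by simpa using hw⟩
      · simp at hw
  refine ⟨φ', Q', ?_, ?_, ?_, ?_, ?_⟩
  · rintro (s | s | s) (t | t | t) hst
    · by_cases hs : c s <;> by_cases ht : c t
      · obtain ⟨_, h1⟩ := p1 s hs
        obtain ⟨_, h2⟩ := p1 t ht
        rw [h1, h2] at hst
        rw [hP.bij.injOn hs.1 ht.1 (by simpa using hst)]
      · obtain ⟨_, h1⟩ := p1 s hs
        rw [h1, p2 t ht] at hst; simp at hst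
      · obtain ⟨_, h1⟩ := p1 t ht
        rw [h1, p2 s hs] at hst; simp at hst
      · rw [p2 s hs, p2 t ht] at hst
        rw [h.inj (Sum.inl_injective hst)]
    · by_cases hs : c s
      · obtain ⟨_, h1⟩ := p1 s hs
        rw [h1] at hst
        have : l' s = t := by simpa [φ'] using hst
        exact absurd t.2 (this ▸ hs.2.2)
      · rw [p2 s hs] at hst; simp [φ'] at hst
    · by_cases hs : c s
      · obtain ⟨_, h1⟩ := p1 s hs
        rw [h1] at hst; simp [φ'] at hst
      · rw [p2 s hs] at hst; simp [φ'] at hst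
    · by_cases hs : c t
      · obtain ⟨_, h1⟩ := p1 t hs
        rw [h1] at hst
        have : s = l' t := by simpa [φ'] using hst
        exact absurd s.2 (this ▸ hs.2.2)
      · rw [p2 t hs] at hst; simp [φ'] at hst
    · have : (s : α) = t := by simpa [φ'] using hst
      rw [Subtype.ext this]
    · simp [φ'] at hst
    · by_cases hs : c t
      · obtain ⟨_, h1⟩ := p1 t hs
        rw [h1] at hst; simp [φ'] at hst
      · rw [p2 t hs] at hst; simp [φ'] at hst
    · simp [φ'] at hst
    · have : s = t := by simpa [φ'] using hst
      rw [this]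
  · rintro (t | t | t) ht
    · obtain ⟨h1, h2, h3⟩ := HE_Lf_l.1 ht
      by_cases hc : c t
      · obtain ⟨_, h5⟩ := p1 t hc
        rw [h5]
        exact ⟨HE_Lf_a, rfl⟩
      · rw [p2 t hc]
        obtain ⟨h5, h6⟩ := lfA t h1
        refine ⟨HE_Lf_l.2 ⟨h5, ?_, fun hh => hR _ hh h5⟩, h6⟩
        rw [h6]
        intro hA
        exact hc ⟨h1, hA, h2⟩
    · exact ⟨HE_Lf_a, rfl⟩
    · exact ⟨HE_Lf_r.2 (AR_Lf.2 (HE_Lf_r.1 ht)), rfl⟩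
  · rintro (s | s | s) (t | t | t) hst <;> try trivial
    · have hst' : E' s t := hst
      have hch : List.IsChain (HE E l A R (AR F y0) none)
          ((φ s :: (Q s t ++ [φ t])).map Sum.inl) := by
        rw [List.isChain_map]
        exact h.path s t hst
      rw [p3 s t hst]
      by_cases hc : c t
      · obtain ⟨hA, h5⟩ := p1 t hc
        rw [h5]
        have : (Sum.inl (φ s) :: (Q' (.inl s) (.inl t) ++ [.inr (.inl ⟨l' t, hA⟩)]) :
            List (V ⊕ (A ⊕ Option W))) = (φ s :: (Q s t ++ [φ t])).map Sum.inl ++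
              [.inr (.inl ⟨l' t, hA⟩)] := by
          simp [Q', hc]
        rw [this, List.isChain_append]
        refine ⟨hch, List.isChain_singleton _, ?_⟩
        intro x hx y hy
        rw [List.map_cons, List.map_append, ← List.cons_append, List.getLast?_append] at hx
        simp at hx hy
        subst hx hy
        exact lfA t hc.1
      · rw [p2 t hc]
        simpa [Q', hc] using hch
    · have hl : φ' (.inl s) = .inl (φ s) := p2 s (fun hc => hc.2.2 (hst.2 ▸ t.2))
      rw [hl]
      simp only [Q', List.nil_append, List.isChain_pair, φ']
      obtain ⟨h5, h6⟩ := lfA s hst.1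
      exact ⟨h5, h6.trans hst.2⟩
    · obtain ⟨rfl, hst⟩ := hst
      have hatt : ¬ c s ∧ att E l A R (φ s) := by
        rcases hst with h1 | h1
        · refine ⟨fun hc => hc.2.2 h1.2, Or.inl ⟨(lfA s h1.1).1, ?_⟩⟩
          rw [(lfA s h1.1).2]; exact hBA h1.2
        · refine ⟨fun hc => hR _ (hRR s h1) (lfA s hc.1).1, Or.inr (hRR s h1)⟩
      rw [p2 s hatt.1]
      simp only [Q', List.cons_append, List.nil_append, List.isChain_cons_cons, φ',
        List.isChain_singleton, and_true]
      exact ⟨⟨rfl, hatt.2⟩, rfl⟩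
    · simp only [Q', List.nil_append, List.isChain_pair, φ']
      exact hst
  · rintro (s | s | s) (t | t | t) hst w hw x hx <;> try (simp [Q'] at hw; done)
    · rcases q1 s t w hw with ⟨v, hv, rfl⟩ | ⟨hc, rfl⟩
      · obtain ⟨r, rfl, hr, rfl⟩ := p4 x _ hx
        exact h.avoid s t hst _ hv r rfl
      · obtain ⟨r, rfl, hr, hr'⟩ := p4 x _ hx
        exact hr (h.inj hr' ▸ hc)
    · simp only [Q', List.mem_singleton] at hw
      subst hw
      rcases x with x | x | x
      · by_cases hs : c x
        · obtain ⟨_, h1⟩ := p1 x hs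
          rw [h1] at hx; simp at hx
        · rw [p2 x hs] at hx; simp at hx
      · simp [φ'] at hx
      · simp [φ'] at hx
  · rintro (s | s | s) (t | t | t) (s' | s' | s') (t' | t' | t') hst hst' hne w hw hw' <;>
      try (simp [Q'] at hw; done)
    all_goals try (simp [Q'] at hw'; done)
    · have hne' : (s, t) ≠ (s', t') := by
        intro hh; apply hne; simpa using hh
      have e1 : E' s t := hst
      have e2 : E' s' t' := hst'
      rcases q1 s t w hw with ⟨v, hv, rfl⟩ | ⟨hc, rfl⟩ <;>
        rcases q1 s' t' _ hw' with ⟨v', hv', hh⟩ | ⟨hc', hh⟩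
      · obtain rfl := Sum.inl_injective hh
        exact h.disj _ _ _ _ e1 e2 hne' v hv hv'
      · obtain rfl := Sum.inl_injective hh
        exact h.avoid s t e1 _ hv t' rfl
      · obtain hh := Sum.inl_injective hh
        exact h.avoid s' t' e2 _ hv' t hh
      · obtain rfl := h.inj (Sum.inl_injective hh)
        obtain rfl := hT _ _ _ e1 e2
        exact hne' rfl
    · rcases q1 s t w hw with ⟨v, hv, rfl⟩ | ⟨hc, rfl⟩ <;> simp [Q'] at hw'
    · rcases q1 s' t' w hw' with ⟨v, hv, rfl⟩ | ⟨hc, rfl⟩ <;> simp [Q'] at hw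
    · obtain ⟨rfl, a⟩ := hst
      obtain ⟨rfl, b⟩ := hst'
      rw [ha _ _ a b] at hne
      exact hne rfl

end Hang
section Rooted

open Relation

variable {V V' : Type}

theorem chain_reach {E : V → V → Prop} (q : List V) : ∀ a, List.IsChain E (a :: q) →
    ∀ w ∈ q, TransGen E a w := by
  induction q with
  | nil => intro a _ w hw; simp at hw
  | cons b q ih =>
    intro a h w hw
    rw [List.isChain_cons_cons] at h
    rcases List.mem_cons.1 hw with rfl | hw
    · exact .single h.1
    · exact (ih b h.2 w hw).head h.1

theorem exists_chain {E : V → V → Prop} {a b : V} (h : TransGen E a b) :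
    ∃ q : List V, List.IsChain E (a :: (q ++ [b])) ∧ ∀ w ∈ q, TransGen E w b := by
  induction h using TransGen.head_induction_on with
  | single h => exact ⟨[], by simpa using h, by simp⟩
  | head h1 h2 ih =>
    rename_i a c
    obtain ⟨q, hq, hq'⟩ := ih
    refine ⟨c :: q, ?_, ?_⟩
    · rw [List.cons_append, List.isChain_cons_cons]
      exact ⟨h1, hq⟩
    · intro w hw
      rcases List.mem_cons.1 hw with rfl | hw
      · exact h2
      · exact hq' w hw

theorem rooted [Finite V] [Fintype V'] {X X' : Finset α} {E : V → V → Prop} {l : V → α}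
    (hE : PN X E l) {ρ : V} (hρ : Rt E ρ) {E' : V' → V' → Prop} {l' : V' → α}
    (hP : PN X' E' l') (hT : Tr E') {φ Q} (h : Emb E l E' l' φ Q) {u v : V'} (huv : E' u v) :
    ∃ (V1 : Type) (_ : Fintype V1) (E1 : V1 → V1 → Prop) (l1 : V1 → α) (φ1 : V1 → V)
      (Q1 : V1 → V1 → List V) (t1 : V1), PN X' E1 l1 ∧ Tr E1 ∧ Emb E l E1 l1 φ1 Q1 ∧
      Rt E1 t1 ∧ φ1 t1 = ρ ∧ ∃ u1 v1, E1 u1 v1 ∧ clus E1 l1 v1 = clus E' l' v := by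
  obtain ⟨t0, ht0, _⟩ := hP.root
  by_cases hφ : φ t0 = ρ
  · exact ⟨V', inferInstance, E', l', φ, Q, t0, hP, hT, h, ht0, hφ, u, v, huv, rfl⟩
  have hstep : ∀ s t, E' s t → ReflTransGen E (φ s) (φ t) := fun s t hst =>
    (chain_reach _ _ (h.path s t hst) _ (by simp)).to_reflTransGen
  have r1 : ∀ t, ReflTransGen E (φ t0) (φ t) := by
    intro t
    have := hP.reach ht0 t
    induction this with
    | refl => exact .refl
    | tail _ hst ih => exact ih.trans (hstep _ _ hst)
  have r2 : ∀ s t, E' s t → ∀ w ∈ Q s t, ReflTransGen E (φ t0) w := by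
    intro s t hst w hw
    exact (r1 s).trans (chain_reach _ _ (h.path s t hst) _ (by simp [hw])).to_reflTransGen
  have hρt : TransGen E ρ (φ t0) := by
    rcases reflTransGen_iff_eq_or_transGen.1 (hE.reach hρ (φ t0)) with h | h
    · exact absurd h hφ
    · exact h
  obtain ⟨q, hq, hq'⟩ := exists_chain hρt
  have key : ∀ w, TransGen E w (φ t0) → ReflTransGen E (φ t0) w → False := fun w h1 h2 =>
    hE.acyc w (h1.trans_left h2)
  by_cases hc : ∃! c, E' t0 c
  · obtain ⟨c, hc, hcu⟩ := hc
    let φ1 : V' → V := fun t => if t = t0 then ρ else φ t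
    let Q1 : V' → V' → List V := fun s t => if s = t0 then q ++ φ t0 :: Q s t else Q s t
    have n1 : ∀ t, t ≠ t0 → φ1 t = φ t := fun t ht => if_neg ht
    have n0 : φ1 t0 = ρ := if_pos rfl
    have m1 : ∀ s t, s ≠ t0 → Q1 s t = Q s t := fun s t ht => if_neg ht
    have m0 : ∀ t, Q1 t0 t = q ++ φ t0 :: Q t0 t := fun t => if_pos rfl
    have hch : ∀ s t, E' s t → t ≠ t0 := fun s t hst hh => ht0 s (hh ▸ hst)
    refine ⟨V', inferInstance, E', l', φ1, Q1, t0, hP, hT, ⟨?_, ?_, ?_, ?_, ?_⟩, ht0, n0, u, v,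
      huv, rfl⟩
    · intro s t hst
      by_cases hs : s = t0 <;> by_cases ht : t = t0
      · rw [hs, ht]
      · subst hs
        rw [n0, n1 t ht] at hst
        exact (key ρ hρt (hst ▸ r1 t)).elim
      · subst ht
        rw [n0, n1 s hs] at hst
        exact (key ρ hρt (hst ▸ r1 s)).elim
      · rw [n1 s hs, n1 t ht] at hst
        exact h.inj hst
    · intro t ht
      have : t ≠ t0 := fun hh => ht c (hh ▸ hc)
      rw [n1 t this]
      exact h.leaf t ht
    · intro s t hst
      rw [n1 t (hch s t hst)]
      by_cases hs : s = t0
      · subst hs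
        rw [n0, m0]
        have h1 := h.path s t hst
        have e : ρ :: ((q ++ φ s :: Q s t) ++ [φ t]) = (ρ :: q) ++ φ s :: (Q s t ++ [φ t]) := by simp
        rw [e, List.isChain_split]
        exact ⟨by simpa using hq, h1⟩
      · rw [n1 s hs, m1 s t hs]
        exact h.path s t hst
    · intro s t hst w hw r hr
      by_cases hs : s = t0
      · subst hs
        rw [m0] at hw
        by_cases hrs : r = s
        · subst hrs
          rw [n0] at hr
          subst hr
          have hlt := chain_reach _ _ hq
          rcases List.mem_append.1 hw with hw | hw
          · exact hE.acyc _ (hlt _ (by simp [hw]))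
          · rcases List.mem_cons.1 hw with hw | hw
            · exact hφ hw.symm
            · exact key _ hρt (r2 r t hst _ hw)
        · rw [n1 r hrs] at hr
          subst hr
          rcases List.mem_append.1 hw with hw | hw
          · exact key _ (hq' _ hw) (r1 r)
          · rcases List.mem_cons.1 hw with hw | hw
            · exact hrs (h.inj hw)
            · exact h.avoid _ _ hst _ hw r rfl
      · rw [m1 s t hs] at hw
        by_cases hrs : r = t0
        · subst hrs
          rw [n0] at hr
          subst hr
          exact key _ hρt (r2 s t hst _ hw)
        · rw [n1 r hrs] at hr
          exact h.avoid _ _ hst _ hw r hr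
    · intro s t s' t' hst hst' hne w hw hw'
      by_cases hs : s = t0 <;> by_cases hs' : s' = t0
      · subst hs
        subst hs'
        rw [hcu t hst, hcu t' hst'] at hne
        exact hne rfl
      · subst hs
        rw [m0] at hw
        rw [m1 _ _ hs'] at hw'
        rcases List.mem_append.1 hw with hw | hw
        · exact key _ (hq' _ hw) (r2 _ _ hst' _ hw')
        · rcases List.mem_cons.1 hw with hw | hw
          · exact h.avoid _ _ hst' _ hw' s hw.symm
          · exact h.disj _ _ _ _ hst hst' hne w hw hw'
      · subst hs'
        rw [m0] at hw'
        rw [m1 _ _ hs] at hw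
        rcases List.mem_append.1 hw' with hw' | hw'
        · exact key _ (hq' _ hw') (r2 _ _ hst _ hw)
        · rcases List.mem_cons.1 hw' with hw' | hw'
          · exact h.avoid _ _ hst _ hw s' hw'.symm
          · exact h.disj _ _ _ _ hst hst' hne w hw hw'
      · rw [m1 _ _ hs] at hw
        rw [m1 _ _ hs'] at hw'
        exact h.disj _ _ _ _ hst hst' hne w hw hw'
  · let φ1 : Option V' → V := fun t => match t with
      | none => ρ
      | some t => φ t
    let Q1 : Option V' → Option V' → List V := fun s t => match s, t with
      | some s, some t => Q s t
      | _, _ => q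
    refine ⟨Option V', inferInstance, AR E' t0, ARl l' t0, φ1, Q1, none, AR_PN hP ht0 hc,
      AR_Tr hT ht0, ⟨?_, ?_, ?_, ?_, ?_⟩, AR_Rt_none, rfl, some u, some v, huv, AR_clus v⟩
    · rintro (_ | s) (_ | t) hst
      · rfl
      · exact (key ρ hρt ((show ρ = φ t from hst) ▸ r1 t)).elim
      · exact (key ρ hρt ((show φ s = ρ from hst) ▸ r1 s)).elim
      · rw [h.inj hst]
    · rintro (_ | t) ht
      · exact absurd ht AR_Lf_none
      · exact h.leaf t (AR_Lf.1 ht)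
    · rintro (_ | s) (_ | t) hst <;> try trivial
      · have : t = t0 := hst
        subst this
        exact hq
      · exact h.path s t hst
    · rintro (_ | s) (_ | t) hst w hw r hr <;> try trivial
      · have hw : w ∈ q := hw
        rcases r with _ | r
        · have hr : ρ = w := hr
          subst hr
          exact hE.acyc _ (chain_reach _ _ hq _ (by simp [hw]))
        · have hr : φ r = w := hr
          subst hr
          exact key _ (hq' _ hw) (r1 r)
      · have hst : E' s t := hst
        have hw : w ∈ Q s t := hw
        rcases r with _ | r
        · have hr : ρ = w := hr
          subst hr
          exact key _ hρt (r2 s t hst _ hw)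
        · exact h.avoid _ _ hst _ hw r hr
    · rintro (_ | s) (_ | t) (_ | s') (_ | t') hst hst' hne w hw hw' <;> try trivial
      · have e1 : t = t0 := hst
        have e2 : t' = t0 := hst'
        rw [e1, e2] at hne
        exact hne rfl
      · exact key _ (hq' _ hw) (r2 s' t' hst' _ hw')
      · exact key _ (hq' _ hw') (r2 s t hst _ hw)
      · refine h.disj _ _ _ _ hst hst' ?_ w hw hw'
        intro hh; apply hne; simpa using hh

end Rooted

section Comb

theorem two_le {m : ℕ} {𝒯 : Fin m → Set (Finset α)} {X S : Finset α}
    (hX : ∀ i, ∀ C ∈ 𝒯 i, C ⊆ X ∧ C.Nonempty)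
    (hc : ∀ i, ∀ C ∈ 𝒯 i, ∀ D ∈ 𝒯 i, Compatible C D)
    (hS : IsMaxSTSet X (⋃ i, 𝒯 i) S) (hSX : S ≠ X) : 2 ≤ m := by
  by_contra hm
  have hsub : ∀ i j : Fin m, i = j := by
    intro i j; apply Fin.ext; have := i.2; have := j.2; omega
  refine hS.2 X ⟨subset_rfl, ?_, ?_⟩ (lt_of_le_of_ne hS.1.1 hSX)
  · intro C hC
    simp only [Set.mem_iUnion] at hC
    obtain ⟨i, hC⟩ := hC
    exact Or.inr (Or.inl (hX i C hC).1)
  · rintro _ ⟨_, C, hC, rfl⟩ _ ⟨_, D, hD, rfl⟩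
    simp only [Set.mem_iUnion] at hC hD
    obtain ⟨i, hC⟩ := hC
    obtain ⟨j, hD⟩ := hD
    obtain rfl := hsub i j
    rw [Finset.inter_eq_left.2 (hX i C hC).1, Finset.inter_eq_left.2 (hX i D hD).1]
    exact hc i C hC D hD

theorem comb {m : ℕ} {𝒯 : Fin m → Set (Finset α)} {X S : Finset α}
    (hX : ∀ i, ∀ C ∈ 𝒯 i, C ⊆ X ∧ C.Nonempty)
    (hc : ∀ i, ∀ C ∈ 𝒯 i, ∀ D ∈ 𝒯 i, Compatible C D)
    (hS : IsMaxSTSet X (⋃ i, 𝒯 i) S) (hS0 : S ≠ ∅) (hSX : S ≠ X) :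
    ∃ (A : Finset α) (b : Prop), A ⊆ X \ S ∧ A.Nonempty ∧
      (∀ C ∈ ⋃ i, 𝒯 i, S ⊂ C → ∃ x ∈ A, x ∈ C) ∧
      (b → A.card + 1 ≤ m) ∧
      (¬ b → 2 ≤ A.card ∧ A.card ≤ m ∧
        ∀ C ∈ ⋃ i, 𝒯 i, C ∩ S = ∅ → ∃ x ∈ A, x ∉ C) := by
  have hm := two_le hX hc hS hSX
  obtain ⟨s, hs⟩ := Finset.nonempty_of_ne_empty hS0
  let Fi : Fin m → α → Prop := fun i x => x ∈ X \ S ∧ ∀ C ∈ 𝒯 i, S ⊂ C → x ∈ C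
  have hF : ∀ i, ∃ x, Fi i x := by
    intro i
    by_cases he : ∃ C, C ∈ 𝒯 i ∧ S ⊂ C
    · have hfin : ({C | C ∈ 𝒯 i ∧ S ⊂ C} : Set (Finset α)).Finite :=
        (Finset.finite_toSet X.powerset).subset fun C hC => by
          simpa using (hX i C hC.1).1
      obtain ⟨C, hC, hmin⟩ := Set.exists_min_image _ Finset.card hfin he
      obtain ⟨x, hx, hxS⟩ := Finset.exists_of_ssubset hC.2
      refine ⟨x, Finset.mem_sdiff.2 ⟨(hX i C hC.1).1 hx, hxS⟩, fun D hD hSD => ?_⟩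
      rcases hc i C hC.1 D hD with h | h | h
      · have : s ∈ C ∩ D := Finset.mem_inter.2 ⟨hC.2.1 hs, hSD.1 hs⟩
        simp [h] at this
      · exact h hx
      · rw [Finset.eq_of_subset_of_card_le h (hmin D ⟨hD, hSD⟩)]; exact hx
    · push Not at he
      obtain ⟨x, hx, hxS⟩ := Finset.exists_of_ssubset (lt_of_le_of_ne hS.1.1 hSX : S ⊂ X)
      exact ⟨x, Finset.mem_sdiff.2 ⟨hx, hxS⟩, fun C hC h => absurd h (he C hC)⟩
  choose f hf using hF
  by_cases h : ∃ i j x, i ≠ j ∧ Fi i x ∧ Fi j x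
  · obtain ⟨i, j, x, hij, hi, hj⟩ := h
    let g : Fin m → α := fun k => if k = i ∨ k = j then x else f k
    have hg : ∀ k, Fi k (g k) := by
      intro k
      by_cases hk : k = i ∨ k = j
      · simp only [g, hk, if_true]
        rcases hk with rfl | rfl
        · exact hi
        · exact hj
      · simp only [g, hk, if_false]; exact hf k
    have hgi : ∀ k, g k ∈ (Finset.univ.erase j).image g := by
      intro k
      by_cases hk : k = j
      · refine Finset.mem_image.2 ⟨i, by simpa using hij, ?_⟩
        simp [g, hk]
      · exact Finset.mem_image.2 ⟨k, by simpa using hk, rfl⟩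
    refine ⟨(Finset.univ.erase j).image g, True, ?_, ⟨_, hgi i⟩, ?_, ?_, by simp⟩
    · intro a ha
      obtain ⟨k, _, rfl⟩ := Finset.mem_image.1 ha
      exact (hg k).1
    · intro C hC hSC
      simp only [Set.mem_iUnion] at hC
      obtain ⟨k, hC⟩ := hC
      exact ⟨g k, hgi k, (hg k).2 C hC hSC⟩
    · intro _
      have := Finset.card_image_le (s := Finset.univ.erase j) (f := g)
      rw [Finset.card_erase_of_mem (Finset.mem_univ _), Finset.card_univ, Fintype.card_fin] at this
      omega
  · push Not at h
    have hinj : Function.Injective f := by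
      intro i j hij
      by_contra hne
      exact h i j (f i) hne (hf i) (hij ▸ hf j)
    have hcard : (Finset.univ.image f).card = m := by
      rw [Finset.card_image_of_injective _ hinj]; simp
    refine ⟨Finset.univ.image f, False, ?_, ⟨f ⟨0, by omega⟩, by simp⟩, ?_, by simp, ?_⟩
    · intro a ha
      obtain ⟨k, _, rfl⟩ := Finset.mem_image.1 ha
      exact (hf k).1
    · intro C hC hSC
      simp only [Set.mem_iUnion] at hC
      obtain ⟨k, hC⟩ := hC
      exact ⟨f k, by simp, (hf k).2 C hC hSC⟩
    · intro _
      refine ⟨by omega, by omega, fun C hC hCS => ?_⟩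
      simp only [Set.mem_iUnion] at hC
      obtain ⟨i, hC⟩ := hC
      by_cases hi : f i ∈ C
      · obtain ⟨j, hj⟩ : ∃ j, i ≠ j := by
          by_cases h0 : i = ⟨0, by omega⟩
          · exact ⟨⟨1, by omega⟩, by simp [h0]⟩
          · exact ⟨_, h0⟩
        refine ⟨f j, by simp, fun hjC => ?_⟩
        apply h i j (f j) hj ⟨(hf j).1, fun D hD hSD => ?_⟩ (hf j)
        rcases hc i C hC D hD with e | e | e
        · have : f i ∈ C ∩ D := Finset.mem_inter.2 ⟨hi, (hf i).2 D hD hSD⟩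
          simp [e] at this
        · exact e hjC
        · have : s ∈ C ∩ S := Finset.mem_inter.2 ⟨e (hSD.1 hs), hs⟩
          simp [hCS] at this
      · exact ⟨f i, by simp, hi⟩

end Comb

section Fin6

variable {V W V' : Type}

theorem hang [Fintype V] [Fintype W] [Fintype V'] {E : V → V → Prop} {l : V → α} {A : Finset α} {R : V → Prop}
    {E' : V' → V' → Prop} {l' : V' → α} {B : Finset α} {R' : V' → Prop}
    {F : W → W → Prop} {lF : W → α} {y0 : W} {φ : V' → V} {Q : V' → V' → List V} {X S C : Finset α}
    (h : Emb E l E' l' φ Q) (hP : PN X E' l') (hT : Tr E')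
    (hBA : B ⊆ A) (hAX : A ⊆ X) (hXS : Disjoint X S)
    (hRR : ∀ t, R' t → R (φ t)) (hR : ∀ v, R v → ¬ Lf E v)
    (hR' : ∀ v, R' v → Rt E' v ∧ ¬ Lf E' v)
    (hne : ∃ u, att E' l' B R' u)
    (ha : ∀ u u', att E' l' B R' u → att E' l' B R' u' → u = u')
    (hF : PN S F lF) (hFT : Tr F) (hy : Rt F y0) (hc : ¬ ∃! w, F y0 w)
    {u v} (huv : HE E' l' B R' F y0 u v) (hC : clus (HE E' l' B R' F y0) (HL l' B lF) v = ↑C) :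
    RepresentsCluster (X ∪ S) (mk _ (HE E l A R (AR F y0) none) (HL l A (ARl lF y0))) C := by
  obtain ⟨φ', Q', hE⟩ := HE_Emb (F := F) (lF := lF) (y0 := y0) h hP hT hBA hRR hR ha
  exact rep_mk _ _ _ _ (HE_PN hP hF hy (hBA.trans hAX) hXS hR' hne (fun hh => hc hh.2)
    (fun _ => ha)) (HE_Tr hP hT hFT hy ha) hE huv hC

/-- tree leaf attachment -/
theorem att_leaf {X : Finset α} {E' : V' → V' → Prop} {l' : V' → α} (hP : PN X E' l') {x : α} (hx : x ∈ X) :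
    ∃ t, Lf E' t ∧ l' t = x ∧ ∀ u, att E' l' {x} (fun _ => False) u ↔ u = t := by
  obtain ⟨t, ht, rfl⟩ := hP.bij.surjOn hx
  refine ⟨t, ht, rfl, fun u => ⟨?_, ?_⟩⟩
  · rintro (⟨h1, h2⟩ | h)
    · exact hP.bij.injOn h1 ht (by simpa using h2)
    · exact h.elim
  · rintro rfl
    exact Or.inl ⟨ht, by simp⟩

end Fin6

section Tree

open Relation

theorem tree_facts {X : Finset α} {T : Net α} (hT : IsPhyloTree X T) :
    (∀ C ∈ clSet T, C ⊆ X ∧ C.Nonempty) ∧ ∀ C ∈ clSet T, ∀ D ∈ clSet T, Compatible C D := by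
  obtain ⟨hP, hTr⟩ := (isPhyloTree_iff X T).1 hT
  refine ⟨?_, ?_⟩
  · rintro _ ⟨e, _, rfl⟩
    refine ⟨?_, ?_⟩
    · rw [← Finset.coe_subset, clus_eq]
      exact clus_sub hP _
    · rw [← Finset.coe_nonempty, clus_eq]
      exact clus_nonempty hP _
  · rintro _ ⟨e, _, rfl⟩ _ ⟨f, _, rfl⟩
    by_cases h : T.clusterBelow e.2 ∩ T.clusterBelow f.2 = ∅
    · exact Or.inl h
    · obtain ⟨a, ha⟩ := Finset.nonempty_of_ne_empty h
      rw [Finset.mem_inter] at ha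
      have h1 : a ∈ clus T.Adj T.label e.2 := by rw [← clus_eq]; exact ha.1
      have h2 : a ∈ clus T.Adj T.label f.2 := by rw [← clus_eq]; exact ha.2
      right
      have := clus_compat hP hTr _ _ h1 h2
      rw [← clus_eq, ← clus_eq, Finset.coe_subset, Finset.coe_subset] at this
      exact this

theorem single_mem {X : Finset α} {T : Net α} (hT : IsPhyloTree X T) {z s : α} (hz : z ∈ X)
    (hs : s ∈ X) (hzs : s ≠ z) : {z} ∈ clSet T := by
  obtain ⟨hP, hTr⟩ := (isPhyloTree_iff X T).1 hT
  obtain ⟨t, ht, hl⟩ := hP.bij.surjOn hz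
  by_cases hr : Rt T.Adj t
  · have := clus_root hP hr
    rw [clus_leaf ht, hl] at this
    have h2 : s ∈ ({z} : Set α) := by rw [this]; exact hs
    exact absurd h2 hzs
  · unfold Rt at hr
    push Not at hr
    obtain ⟨u, hu⟩ := hr
    refine ⟨(u, t), hu, ?_⟩
    rw [← Finset.coe_inj, clus_eq, clus_leaf ht, hl]; simp

theorem rep_emb {X C : Finset α} {N : Net α} (h : RepresentsCluster X N C) :
    ∃ (V : Type) (_ : Fintype V) (E : V → V → Prop) (l : V → α) (φ : V → Fin N.n) (Q : V → V → List (Fin N.n)),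
      PN X E l ∧ Tr E ∧ Emb N.Adj N.label E l φ Q ∧ ∃ u v, E u v ∧ clus E l v = ↑C := by
  obtain ⟨T, hT, hD, e, he, hC⟩ := h
  obtain ⟨hP, hTr⟩ := (isPhyloTree_iff X T).1 hT
  obtain ⟨φ, Q, hE⟩ := emb_of_disp hD
  exact ⟨_, inferInstance, T.Adj, T.label, φ, Q, hP, hTr, hE, e.1, e.2, he, by rw [← clus_eq, hC]⟩

theorem att_ncard {V : Type} [Fintype V] {X A : Finset α} {E : V → V → Prop} {l : V → α} {b : Prop} {ρ : V}
    (hP : PN X E l) {m : ℕ} (h1 : b → A.card + 1 ≤ m) (h2 : ¬ b → A.card ≤ m) :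
    ({u | att E l A (fun v => b ∧ v = ρ) u} : Set V).ncard ≤ m := by
  have hl : ({u | Lf E u ∧ l u ∈ A} : Set V).ncard ≤ A.card := by
    rw [← Set.ncard_coe_finset]
    exact Set.ncard_le_ncard_of_injOn l (fun u hu => hu.2)
      (fun u hu v hv h => hP.bij.injOn hu.1 hv.1 h) (Finset.finite_toSet _)
  by_cases hb : b
  · have : ({u | att E l A (fun v => b ∧ v = ρ) u} : Set V) ⊆ insert ρ {u | Lf E u ∧ l u ∈ A} := by
      rintro u (h | h)
      · exact Or.inr h
      · exact Or.inl h.2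
    have h3 := Set.ncard_le_ncard this (Set.toFinite _)
    have h4 := Set.ncard_insert_le ρ {u | Lf E u ∧ l u ∈ A}
    have := h1 hb
    omega
  · have : ({u | att E l A (fun v => b ∧ v = ρ) u} : Set V) ⊆ {u | Lf E u ∧ l u ∈ A} := by
      rintro u (h | h)
      · exact h
      · exact absurd h.1 hb
    have h3 := Set.ncard_le_ncard this (Set.toFinite _)
    have := h2 hb
    omega

end Tree

open Relation in
theorem main_aux (X : Finset α) (m : ℕ)
    (T : Fin m → Net α) (hT : ∀ i, IsPhyloTree X (T i))
    (S : Finset α) (hS : IsMaxSTSet X (⋃ i, clSet (T i)) S)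
    (hS0 : S ≠ ∅) (hSX : S ≠ X)
    (N : Net α) (hN : IsPhyloNet (X \ S) N)
    (hrep : RepresentsSet (X \ S) N (removeTaxa (⋃ i, clSet (T i)) S)) :
    ∃ N' : Net α, IsPhyloNet X N' ∧ RepresentsSet X N' (⋃ i, clSet (T i)) ∧
      N'.reticNum ≤ N.reticNum + (m - 1) := by
  have hX := fun i => (tree_facts (hT i)).1
  have hc := fun i => (tree_facts (hT i)).2
  have hm := two_le hX hc hS hSX
  obtain ⟨A, b, hAX, ⟨x0, hx0⟩, hA1, hb1, hb2⟩ := comb hX hc hS hS0 hSX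
  have hSne := Finset.nonempty_of_ne_empty hS0
  obtain ⟨s, hs⟩ := hSne
  have hXe : (X \ S) ∪ S = X := Finset.sdiff_union_of_subset hS.1.1
  have hdis : Disjoint (X \ S) S := Finset.sdiff_disjoint
  have hx0' := Finset.mem_sdiff.1 (hAX hx0)
  have hPN := (isPhyloNet_iff _ _).1 hN
  obtain ⟨ρ, hρ, hρu⟩ := hPN.root
  have hmU : ∀ C, C ∈ (⋃ i, clSet (T i)) → C ⊆ X ∧ C.Nonempty := by
    intro C hC
    simp only [Set.mem_iUnion] at hC
    obtain ⟨i, hC⟩ := hC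
    exact hX i C hC
  -- a singleton cluster
  have hz : RepresentsCluster (X \ S) N {x0} := by
    apply hrep
    refine ⟨by simp, {x0}, ?_, ?_⟩
    · simp only [Set.mem_iUnion]
      refine ⟨⟨0, by omega⟩, single_mem (hT _) hx0'.1 (hS.1.1 hs) ?_⟩
      rintro rfl; exact hx0'.2 hs
    · rw [Finset.sdiff_eq_self_of_disjoint]; simpa using hx0'.2
  -- hierarchy tree on S
  obtain ⟨W, _, F, lF, y0, hF, hFT, hy, hcy, hH⟩ := exists_hier S ⟨s, hs⟩
    {C | C ∈ (⋃ i, clSet (T i)) ∧ C ⊆ S} (fun C hC => ⟨hC.2, (hmU C hC.1).2⟩) (by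
      intro C hC D hD
      apply hS.1.2.2 C ⟨(hmU C hC.1).2, C, hC.1, (Finset.inter_eq_left.2 hC.2).symm⟩
        D ⟨(hmU D hD.1).2, D, hD.1, (Finset.inter_eq_left.2 hD.2).symm⟩)
  have hρl : ¬ Lf N.Adj ρ := by
    obtain ⟨V1, _, E1, l1, φ, Q, hP1, hT1, hE1, u, v, huv, hv⟩ := rep_emb hz
    intro hl
    have h1 := reach_leaf hl (hPN.reach hρ (φ u))
    have h2 := reach_leaf hl (hPN.reach hρ (φ v))
    have := hE1.inj (h1.trans h2.symm)
    subst this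
    exact hP1.acyc _ (TransGen.single huv)
  let R : Fin N.n → Prop := fun v => b ∧ v = ρ
  have hR : ∀ v, R v → Rt N.Adj v ∧ ¬ Lf N.Adj v := by
    rintro v ⟨_, rfl⟩; exact ⟨hρ, hρl⟩
  have hR2 : ∀ v, R v → ¬ Lf N.Adj v := fun v hv => (hR v hv).2
  have hlf : ∀ x ∈ A, ∃ u, Lf N.Adj u ∧ N.label u = x ∧ att N.Adj N.label A R u := by
    intro x hx
    obtain ⟨u, hu, rfl⟩ := hPN.bij.surjOn (hAX hx)
    exact ⟨u, hu, rfl, Or.inl ⟨hu, hx⟩⟩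
  refine ⟨mk _ (HE N.Adj N.label A R (AR F y0) none) (HL N.label A (ARl lF y0)), ?_, ?_, ?_⟩
  · rw [isPhyloNet_iff]
    apply mk_PN
    have := HE_PN hPN (AR_PN hF hy hcy) AR_Rt_none hAX hdis hR (A := A) ?_ ?_ ?_
    · rwa [hXe] at this
    · obtain ⟨u, _, _, h⟩ := hlf x0 hx0
      exact ⟨u, h⟩
    · rintro ⟨⟨a, _, ha⟩, _⟩
      obtain ⟨u, hu, hux, h⟩ := hlf x0 hx0
      by_cases hb : b
      · have h1 := ha ρ (Or.inr ⟨hb, rfl⟩)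
        have h2 := ha u h
        rw [h1, ← h2] at hρl
        exact hρl hu
      · obtain ⟨x1, hx1, hne⟩ := Finset.exists_mem_ne (by have := (hb2 hb).1; omega : 1 < A.card) x0
        obtain ⟨u', hu', hux', h'⟩ := hlf x1 hx1
        have h1 := ha u h
        have h2 := ha u' h'
        apply hne
        rw [← hux, ← hux', h1, h2]
    · intro h; exact absurd h AR_Lf_none
  · intro C hC
    have hCX := hmU C hC
    -- hang at a leaf
    have hleaf : ∀ {D : Finset α} {x : α}, x ∈ A → RepresentsCluster (X \ S) N D →
        (C ⊆ S ∨ ((x ∈ D → C = D ∪ S) ∧ (x ∉ D → C = D))) →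
        RepresentsCluster X (mk _ (HE N.Adj N.label A R (AR F y0) none) (HL N.label A (ARl lF y0))) C := by
      intro D x hx hD hor
      obtain ⟨V1, _, E1, l1, φ, Q, hP1, hT1, hE1, u, v, huv, hv⟩ := rep_emb hD
      obtain ⟨t, ht, hl, hat⟩ := att_leaf hP1 (hAX hx)
      have key := @hang α _ (Fin N.n) W V1 _ _ _ N.Adj N.label A R E1 l1 {x} (fun _ => False) F lF y0 φ Q
        (X \ S) S C hE1 hP1 hT1 (by simpa using hx) hAX hdis (fun _ h => h.elim) hR2 (fun _ h => h.elim)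
        ⟨t, (hat t).2 rfl⟩ (fun u u' h h' => ((hat u).1 h).trans ((hat u').1 h').symm) hF hFT hy hcy
      rw [hXe] at key
      have hcl := HE_clus_l (E := E1) (l := l1) (A := {x}) (R := fun _ => False) hF hy
        (fun _ h => h.elim) v
      have hxv : x ∈ D ↔ ReflTransGen E1 v t := by
        rw [← Finset.mem_coe, ← hv]
        constructor
        · rintro ⟨w, h1, h2, h3⟩
          rwa [← hP1.bij.injOn h2 ht (h3.trans hl.symm)]
        · intro h; exact ⟨t, h, ht, hl⟩
      rcases hor with hCS | ⟨hin, hout⟩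
      · by_cases hCe : C = S
        · refine key (u := .inl t) (v := .inr (.inr y0)) ⟨rfl, (hat t).2 rfl⟩ ?_
          rw [HE_clus_r, clus_root hF hy, hCe]
        · obtain ⟨u', v', huv', hcv'⟩ := hH C ⟨hC, hCS⟩ hCe
          refine key (u := .inr (.inr u')) (v := .inr (.inr v')) huv' ?_
          rw [HE_clus_r, hcv']
      by_cases hxD : x ∈ D
      · refine key (u := .inl u) (v := .inl v) huv ?_
        rw [hcl, hv, hin hxD, Finset.coe_union]
        congr 1
        ext a
        simp only [Set.mem_ofPred_eq, Finset.mem_coe, and_iff_left_iff_imp]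
        intro _
        exact ⟨t, hxv.1 hxD, (hat t).2 rfl⟩
      · have hCD := hout hxD
        refine key (u := .inl u) (v := .inl v) huv ?_
        rw [hcl, hv, hCD, Set.union_eq_left]
        rintro a ⟨_, w, hw, hw2⟩
        rw [(hat w).1 hw2] at hw
        exact absurd (hxv.2 hw) hxD
    by_cases hCS : C ⊆ S
    · exact hleaf hx0 hz (Or.inl hCS)
    have hne : (C \ S).Nonempty := Finset.sdiff_nonempty.2 hCS
    have hD : RepresentsCluster (X \ S) N (C \ S) := hrep _ ⟨hne, C, hC, rfl⟩
    rcases hS.1.2.1 C hC with h | h | h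
    · have hd : C \ S = C := Finset.sdiff_eq_self_of_disjoint (Finset.disjoint_iff_inter_eq_empty.2 h)
      rw [hd] at hD
      by_cases hb : b
      · obtain ⟨V0, _, E0, l0, φ0, Q0, hP0, hT0, hE0, u0, v0, huv0, hv0⟩ := rep_emb hD
        obtain ⟨V1, _, E1, l1, φ, Q, t, hP1, hT1, hE1, ht, htρ, u, v, huv, hv⟩ :=
          rooted hPN hρ hP0 hT0 hE0 huv0
        rw [hv0] at hv
        have htl : ¬ Lf E1 t := by
          intro hl
          have h1 := reach_leaf hl (hP1.reach ht u)
          subst h1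
          exact hl _ huv
        have hat : ∀ w, att E1 l1 ∅ (fun w => w = t) w ↔ w = t := by
          intro w; simp [att]
        have hR' : ∀ w, w = t → Rt E1 w ∧ ¬ Lf E1 w := by
          rintro w rfl; exact ⟨ht, htl⟩
        have key := @hang α _ (Fin N.n) W V1 _ _ _ N.Adj N.label A R E1 l1 ∅ (fun w => w = t) F lF y0 φ Q
          (X \ S) S C hE1 hP1 hT1 (by simp) hAX hdis (fun w h => ⟨hb, by rw [h, htρ]⟩) hR2 hR'
          ⟨t, (hat t).2 rfl⟩ (fun u u' h h' => ((hat u).1 h).trans ((hat u').1 h').symm) hF hFT hy hcy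
        rw [hXe] at key
        refine key (u := .inl u) (v := .inl v) huv ?_
        rw [HE_clus_l hF hy hR' v, hv, Set.union_eq_left]
        rintro a ⟨_, w, hw, hw2⟩
        rw [(hat w).1 hw2] at hw
        have := reach_root ht hw
        subst this
        exact absurd huv (ht _)
      · obtain ⟨x, hx, hxC⟩ := (hb2 hb).2.2 C hC h
        exact hleaf hx hD (Or.inr ⟨fun hh => absurd hh hxC, fun _ => rfl⟩)
    · exact absurd h hCS
    · obtain ⟨x, hx, hxC⟩ := hA1 C hC (Finset.ssubset_iff_subset_ne.2 ⟨h, by rintro rfl; exact hCS subset_rfl⟩)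
      have hxS := (Finset.mem_sdiff.1 (hAX hx)).2
      exact hleaf hx hD (Or.inr ⟨fun _ => (Finset.sdiff_union_of_subset h).symm,
        fun hh => absurd (Finset.mem_sdiff.2 ⟨hxC, hxS⟩) hh⟩)
  · rw [reticNum_eq, reticNum_eq, mk_rr]
    refine (HE_rr hPN (AR_Tr hFT hy) AR_Rt_none).trans ?_
    have := att_ncard (ρ := ρ) hPN hb1 (fun hb => (hb2 hb).2.1)
    have h2 : ({u | att N.Adj N.label A R u} : Set (Fin N.n)).ncard ≤ m := this
    omega
/-- hanging back a maximal ST-set.  Let `𝒞 = Cl(𝒯)` for `m` trees on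
`X`, let `S` be a maximal non-trivial ST-set of `𝒞` and let `N` be a network on `X \ S`
representing `𝒞 \ S`.  Then there is a network `N'` on `X` representing `𝒞` with
`r(N') ≤ r(N) + (m − 1)`. -/
theorem exists_hang_back {α : Type} [DecidableEq α] (X : Finset α) (m : ℕ)
    (T : Fin m → Net α) (hT : ∀ i, IsPhyloTree X (T i))
    (S : Finset α) (hS : IsMaxSTSet X (⋃ i, clSet (T i)) S)
    (hS0 : S ≠ ∅) (hSX : S ≠ X)
    (N : Net α) (hN : IsPhyloNet (X \ S) N)
    (hrep : RepresentsSet (X \ S) N (removeTaxa (⋃ i, clSet (T i)) S)) :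
    ∃ N' : Net α, IsPhyloNet X N' ∧ RepresentsSet X N' (⋃ i, clSet (T i)) ∧
      N'.reticNum ≤ N.reticNum + (m - 1) := by
  exact main_aux X m T hT S hS hS0 hSX N hN hrep

end Phylo
end

section
/- If T' is a subtree below a reticulation (SBR) of a rooted phylogenetic network N on X that represents a cluster set C, and T' has taxa set X', then X' is an ST-set with respect to C. -/
open scoped Classical

namespace Phylo

variable {α : Type} [DecidableEq α]

theorem rtg_cross {β : Type} {R : β → β → Prop} (p : β → Prop) {a w : β}
    (h : Relation.ReflTransGen R a w) (ha : ¬ p a) (hw : p w) :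
    ∃ b c, Relation.ReflTransGen R a b ∧ R b c ∧ ¬ p b ∧ p c ∧ Relation.ReflTransGen R c w := by
  induction h with
  | refl => exact absurd hw ha
  | @tail b c h1 h2 ih =>
    by_cases hb : p b
    · obtain ⟨x, y, h3, h4, h5, h6, h7⟩ := ih hb
      exact ⟨x, y, h3, h4, h5, h6, h7.tail h2⟩
    · exact ⟨b, c, h1, h2, hb, hw, .refl⟩

theorem parent_unique (N : Net α) {q a b : Fin N.n} (hq : N.indeg q < 2)
    (ha : (a, q) ∈ N.E) (hb : (b, q) ∈ N.E) : a = b := by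
  have h : (N.E.filter fun e => e.2 = q).card ≤ 1 := Nat.lt_succ_iff.mp hq
  have := Finset.card_le_one.mp h (a, q) (by simp [ha]) (b, q) (by simp [hb])
  exact congrArg Prod.fst this

def Good (N : Net α) (u : Fin N.n) : Prop :=
  ∀ q, N.Reaches u q → q ≠ u → N.indeg q < 2

theorem good_enter (N : Net α) {u p q : Fin N.n} (hu : Good N u) (hpq : (p, q) ∈ N.E)
    (hp : ¬ N.Reaches u p) (hq : N.Reaches u q) : q = u := by
  by_contra hne
  rcases Relation.ReflTransGen.cases_tail hq with h | ⟨c, h1, h2⟩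
  · exact hne h
  · have := parent_unique N (hu q hq hne) hpq h2
    subst this
    exact hp h1

theorem good_list (N : Net α) {u : Fin N.n} (hu : Good N u) (t : List (Fin N.n)) :
    ∀ a b, (a :: t).IsChain N.Adj → (a :: t).getLast? = some b → ¬ N.Reaches u a →
      N.Reaches u b → u ∈ t := by
  induction t with
  | nil =>
    intro a b _ h ha hb
    simp at h
    subst h
    exact absurd hb ha
  | cons c t ih =>
    intro a b hc hl ha hb
    rw [List.isChain_cons_cons] at hc
    by_cases h : N.Reaches u c
    · rw [good_enter N hu hc.1 ha h]
      simp
    · refine List.mem_cons_of_mem _ (ih c b hc.2 ?_ h hb)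
      simpa using hl

theorem good_path (N : Net α) {u a b : Fin N.n} (hu : Good N u) {p : List (Fin N.n)}
    (hp : IsDirPath N a b p) (ha : ¬ N.Reaches u a) (hb : N.Reaches u b) :
    u = b ∨ u ∈ internals p := by
  obtain ⟨h1, h2, h3, h4⟩ := hp
  cases p with
  | nil => simp at h1
  | cons x t =>
    simp at h1
    subst h1
    have hm := good_list N hu t x b h3 h2 ha hb
    have ht : t ≠ [] := List.ne_nil_of_mem hm
    have hl : t.getLast ht = b := by
      rw [List.getLast?_eq_getLast_of_ne_nil (by simp), List.getLast_cons ht] at h2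
      exact Option.some.inj h2
    rw [← List.dropLast_append_getLast ht, List.mem_append] at hm
    rcases hm with hm | hm
    · exact Or.inr hm
    · left
      rw [← hl]
      simpa using hm

theorem path_reaches (N : Net α) (t : List (Fin N.n)) :
    ∀ a b, (a :: t).IsChain N.Adj → (a :: t).getLast? = some b → N.Reaches a b := by
  induction t with
  | nil =>
    intro a b _ h
    simp at h
    subst h
    exact .refl
  | cons c t ih =>
    intro a b hc hl
    rw [List.isChain_cons_cons] at hc
    exact .head hc.1 (ih c b hc.2 (by simpa using hl))

theorem dirPath_reaches (N : Net α) {a b : Fin N.n} {p : List (Fin N.n)}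
    (hp : IsDirPath N a b p) : N.Reaches a b := by
  obtain ⟨h1, h2, h3, h4⟩ := hp
  cases p with
  | nil => simp at h1
  | cons x t =>
    simp at h1
    subst h1
    exact path_reaches N t x b h3 h2

theorem reaches_antisymm (N : Net α) (hac : ∀ v : Fin N.n, ¬ Relation.TransGen N.Adj v v)
    {a b : Fin N.n} (h1 : N.Reaches a b) (h2 : N.Reaches b a) : a = b := by
  rcases Relation.reflTransGen_iff_eq_or_transGen.mp h1 with h | h
  · exact h.symm
  · exact absurd (h.trans_left h2) (hac a)

theorem root_reaches (N : Net α) (hac : ∀ v : Fin N.n, ¬ Relation.TransGen N.Adj v v)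
    (hr : ∃! ρ : Fin N.n, N.indeg ρ = 0) : ∃ ρ, ∀ v, N.Reaches ρ v := by
  obtain ⟨ρ, -, hρ⟩ := hr
  refine ⟨ρ, fun v => ?_⟩
  haveI : IsTrans (Fin N.n) (Relation.TransGen N.Adj) := ⟨fun _ _ _ => Relation.TransGen.trans⟩
  haveI : Std.Irrefl (Relation.TransGen N.Adj) := ⟨hac⟩
  have wf := Finite.wellFounded_of_trans_of_irrefl (Relation.TransGen N.Adj)
  induction v using wf.induction with
  | _ v ih =>
    by_cases h : N.indeg v = 0
    · rw [hρ v h]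
      exact .refl
    · obtain ⟨⟨a, b⟩, he⟩ := Finset.card_pos.mp (Nat.pos_of_ne_zero h)
      simp only [Finset.mem_filter] at he
      obtain ⟨he, rfl⟩ := he
      exact (ih a (.single he)).tail he

theorem tree_indeg (N : Net α) (h : N.reticNum = 0) (v : Fin N.n) : N.indeg v < 2 := by
  have := (Finset.sum_eq_zero_iff.mp h) v (Finset.mem_univ v)
  omega

theorem mem_clusterBelow (N : Net α) (v : Fin N.n) (x : α) :
    x ∈ N.clusterBelow v ↔ ∃ w, N.Reaches v w ∧ N.IsLeaf w ∧ N.label w = x := by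
  simp [Net.clusterBelow, and_assoc]

/-- The taxa set of an isomorphic subnetwork is the cluster of its root. -/
theorem iso_cluster {X' : Finset α} {N T : Net α} (hT : IsPhyloNet X' T) {r : Fin N.n}
    (h : IsoSubnetAt N r T) : N.clusterBelow r = X' := by
  obtain ⟨g, hg, hrange, hE, hlab⟩ := h
  have hleaf : ∀ a, T.IsLeaf a ↔ N.IsLeaf (g a) := by
    intro a
    have hr : N.Reaches r (g a) := by
      have : g a ∈ Set.range g := ⟨a, rfl⟩
      rw [hrange] at this
      exact this
    simp only [Net.IsLeaf, Net.outdeg, Finset.card_eq_zero, Finset.filter_eq_empty_iff]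
    constructor
    · rintro h ⟨x, y⟩ he hx
      simp only at hx
      subst hx
      have : y ∈ Set.range g := by
        rw [hrange]
        exact hr.tail he
      obtain ⟨b, rfl⟩ := this
      exact h ((hE a b).mpr he) rfl
    · rintro h ⟨x, y⟩ he hx
      simp only at hx
      subst hx
      exact h ((hE x y).mp he) rfl
  have hbij := hT.2.2.2.2
  ext x
  rw [mem_clusterBelow]
  constructor
  · rintro ⟨w, hw, hl, rfl⟩
    have : w ∈ Set.range g := by
      rw [hrange]
      exact hw
    obtain ⟨a, rfl⟩ := this
    rw [hlab a ((hleaf a).mpr hl)]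
    exact hbij.mapsTo ((hleaf a).mpr hl)
  · intro hx
    obtain ⟨a, ha, rfl⟩ := hbij.surjOn hx
    have : g a ∈ Set.range g := ⟨a, rfl⟩
    rw [hrange] at this
    exact ⟨g a, this, (hleaf a).mp ha, hlab a ha⟩

/-- Main dichotomy for a represented cluster. -/
theorem cluster_cases {X : Finset α} {N : Net α} (hN : IsPhyloNet X N) {r : Fin N.n}
    (hgood : ∀ u, N.Reaches r u → Good N u) {C : Finset α} (hC : RepresentsCluster X N C) :
    (∃ u, N.Reaches r u ∧ C = N.clusterBelow u) ∨ C ∩ N.clusterBelow r = ∅ ∨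
      N.clusterBelow r ⊆ C := by
  obtain ⟨T, ⟨hT, hret⟩, ⟨φ, hφ, hleaf, P, hP, hint, hdis⟩, ⟨x, y⟩, he, rfl⟩ := hC
  simp only
  obtain ⟨ρ, hρ⟩ := root_reaches T hT.1 hT.2.1
  have hmap : ∀ a b, T.Reaches a b → N.Reaches (φ a) (φ b) := by
    intro a b h
    induction h with
    | refl => exact .refl
    | tail _ h2 ih => exact ih.trans (dirPath_reaches N (hP _ h2))
  have hNlab := hN.2.2.2.2
  have hTlab := hT.2.2.2.2
  -- every leaf of N is the image of a leaf of T
  have hlift : ∀ w, N.IsLeaf w → ∃ l, T.IsLeaf l ∧ φ l = w := by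
    intro w hw
    obtain ⟨l, hl, hlw⟩ := hTlab.surjOn (hNlab.mapsTo hw)
    refine ⟨l, hl, hNlab.injOn (hleaf l hl).1 hw ?_⟩
    rw [(hleaf l hl).2, hlw]
  by_cases hy : N.Reaches r (φ y)
  · left
    refine ⟨φ y, hy, ?_⟩
    ext z
    rw [mem_clusterBelow, mem_clusterBelow]
    constructor
    · rintro ⟨l, h1, h2, rfl⟩
      exact ⟨φ l, hmap _ _ h1, (hleaf l h2).1, (hleaf l h2).2⟩
    · rintro ⟨w, h1, h2, rfl⟩
      obtain ⟨l, hl, rfl⟩ := hlift w h2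
      refine ⟨l, ?_, hl, (hleaf l hl).2.symm⟩
      by_cases hr : N.Reaches (φ y) (φ ρ)
      · have := hφ (reaches_antisymm N hN.1 hr (hmap _ _ (hρ y)))
        rw [this]
        exact hρ l
      · obtain ⟨a, b, h3, h4, h5, h6, h7⟩ :=
          rtg_cross (fun t => N.Reaches (φ y) (φ t)) (hρ l) hr h1
        rcases good_path N (hgood _ hy) (hP _ h4) h5 h6 with h | h
        · rw [hφ h]
          exact h7
        · exact absurd ⟨y, rfl⟩ (hint _ h4 _ h)
  · right
    rw [or_iff_not_imp_left]
    intro hne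
    obtain ⟨z, hz⟩ := Finset.nonempty_iff_ne_empty.mpr hne
    rw [Finset.mem_inter, mem_clusterBelow, mem_clusterBelow] at hz
    obtain ⟨⟨l, h1, h2, h3⟩, w, h4, h5, h6⟩ := hz
    have hw : φ l = w := by
      refine hNlab.injOn (hleaf l h2).1 h5 ?_
      rw [(hleaf l h2).2, h3, h6]
    subst hw
    obtain ⟨a, b, k1, k2, k3, k4, k5⟩ := rtg_cross (fun t => N.Reaches r (φ t)) h1 hy h4
    have hρr : ¬ N.Reaches r (φ ρ) := fun h => hy (h.trans (hmap _ _ (hρ y)))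
    intro z' hz'
    rw [mem_clusterBelow] at hz'
    obtain ⟨w', m1, m2, rfl⟩ := hz'
    obtain ⟨l', hl', rfl⟩ := hlift w' m2
    obtain ⟨a', b', n1, n2, n3, n4, n5⟩ :=
      rtg_cross (fun t => N.Reaches r (φ t)) (hρ l') hρr m1
    have hbb : b = b' := by
      rcases good_path N (hgood r .refl) (hP _ k2) k3 k4 with h | h
      · rcases good_path N (hgood r .refl) (hP _ n2) n3 n4 with h' | h'
        · exact hφ (h.symm.trans h')
        · exact absurd ⟨b, h.symm⟩ (hint _ n2 _ h')
      · rcases good_path N (hgood r .refl) (hP _ n2) n3 n4 with h' | h'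
        · exact absurd ⟨b', h'.symm⟩ (hint _ k2 _ h)
        · by_contra hne'
          exact hdis _ k2 _ n2 (fun h => hne' (congrArg Prod.snd h)) _ h h'
    subst hbb
    rw [mem_clusterBelow]
    exact ⟨l', (k1.tail k2).trans n5, hl', (hleaf l' hl').2.symm⟩

theorem laminar {X : Finset α} {N : Net α} (hN : IsPhyloNet X N) {u u' : Fin N.n}
    (hu : Good N u) : Compatible (N.clusterBelow u) (N.clusterBelow u') := by
  have hmono : ∀ a b, N.Reaches a b → N.clusterBelow b ⊆ N.clusterBelow a := by
    intro a b h z hz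
    rw [mem_clusterBelow] at hz ⊢
    obtain ⟨w, h1, h2⟩ := hz
    exact ⟨w, h.trans h1, h2⟩
  unfold Compatible
  rw [or_iff_not_imp_left]
  intro hne
  obtain ⟨z, hz⟩ := Finset.nonempty_iff_ne_empty.mpr hne
  rw [Finset.mem_inter, mem_clusterBelow, mem_clusterBelow] at hz
  obtain ⟨⟨w, h1, h2, h3⟩, w', h4, h5, h6⟩ := hz
  have hw : w = w' := hN.2.2.2.2.injOn h2 h5 (h3.trans h6.symm)
  subst hw
  by_cases h : N.Reaches u u'
  · exact Or.inr (hmono _ _ h)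
  · obtain ⟨b, c, k1, k2, k3, k4, k5⟩ := rtg_cross (fun t => N.Reaches u t) h4 h h1
    have := good_enter N hu k2 k3 k4
    subst this
    exact Or.inl (hmono _ _ (k1.tail k2))

/-- If `T'` is a subtree below a reticulation (SBR) of a network `N`
on `X` representing the cluster set `𝒞`, and `T'` has taxa set `X'`, then `X'` is an
ST-set with respect to `𝒞`. -/
theorem taxaSet_of_SBR_isSTSet {α : Type} [DecidableEq α] (X : Finset α)
    (𝒞 : Set (Finset α)) (h𝒞 : IsClusterSet X 𝒞)
    (N : Net α) (hN : IsPhyloNet X N) (hrep : RepresentsSet X N 𝒞)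
    (X' : Finset α) (hX' : X' ⊂ X) (T' : Net α) (hT' : IsPhyloTree X' T')
    (hsbr : IsSBR N T') :
    IsSTSet X 𝒞 X' := by
  have key : ∃ r : Fin N.n, (∀ u, N.Reaches r u → Good N u) ∧ N.clusterBelow r = X' := by
    obtain ⟨v, -, hv, h⟩ := hsbr
    have hg : ∀ u, N.Reaches v u → Good N u := by
      intro u hu q hq hne
      refine hv q (hu.trans hq) ?_
      rintro rfl
      exact hne (reaches_antisymm N hN.1 hu hq)
    rcases h with ⟨-, c, hc, hi⟩ | ⟨-, hi⟩
    · exact ⟨c, fun u hu => hg u (.head hc hu), iso_cluster hT'.1 hi⟩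
    · exact ⟨v, hg, iso_cluster hT'.1 hi⟩
  obtain ⟨r, hgood, rfl⟩ := key
  have hmono : ∀ a b, N.Reaches a b → N.clusterBelow b ⊆ N.clusterBelow a := by
    intro a b h z hz
    rw [mem_clusterBelow] at hz ⊢
    obtain ⟨w, h1, h2⟩ := hz
    exact ⟨w, h.trans h1, h2⟩
  have hres : ∀ D ∈ restrictTo 𝒞 (N.clusterBelow r),
      ∃ u, N.Reaches r u ∧ D = N.clusterBelow u := by
    rintro D ⟨hD, C, hC, rfl⟩
    rcases cluster_cases hN hgood (hrep C hC) with ⟨u, hu, rfl⟩ | h | h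
    · exact ⟨u, hu, Finset.inter_eq_left.mpr (hmono _ _ hu)⟩
    · exact absurd h hD.ne_empty
    · exact ⟨r, .refl, Finset.inter_eq_right.mpr h⟩
  refine ⟨hX'.1, ?_, ?_⟩
  · intro C hC
    rcases cluster_cases hN hgood (hrep C hC) with ⟨u, hu, rfl⟩ | h | h
    · exact Or.inr (Or.inl (hmono _ _ hu))
    · exact Or.inl h
    · exact Or.inr (Or.inr h)
  · intro A hA B hB
    obtain ⟨u, hu, rfl⟩ := hres A hA
    obtain ⟨u', hu', rfl⟩ := hres B hB
    exact laminar hN (hgood u hu)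

end Phylo
end

section
/- Let C be a set of clusters on a finite taxa set X and let S_1 ≠ S_2 be two ST-sets of C. If S_1 ∩ S_2 ≠ ∅, then S_1 ∪ S_2 is an ST-set of C. -/
open scoped Classical

namespace Phylo

variable {α : Type} [DecidableEq α]

/-- If `S₁ ≠ S₂` are two ST-sets of a cluster set `𝒞` on `X` with
`S₁ ∩ S₂ ≠ ∅`, then `S₁ ∪ S₂` is an ST-set of `𝒞`. -/
theorem stset_union_of_inter_nonempty {α : Type} [DecidableEq α] (X : Finset α)
    (𝒞 : Set (Finset α)) (h𝒞 : IsClusterSet X 𝒞)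
    (S₁ S₂ : Finset α) (h₁ : IsSTSet X 𝒞 S₁) (h₂ : IsSTSet X 𝒞 S₂)
    (hne : S₁ ≠ S₂) (hint : S₁ ∩ S₂ ≠ ∅) :
    IsSTSet X 𝒞 (S₁ ∪ S₂) := by
  obtain ⟨hX₁, hU₁, hP₁⟩ := h₁
  obtain ⟨hX₂, hU₂, hP₂⟩ := h₂
  obtain ⟨p, hp⟩ := Finset.nonempty_iff_ne_empty.mpr hint
  obtain ⟨hp₁, hp₂⟩ := Finset.mem_inter.mp hp
  have key : ∀ C ∈ 𝒞, C ∩ (S₁ ∪ S₂) = ∅ ∨ S₁ ∪ S₂ ⊆ C ∨ C ⊆ S₁ ∨ C ⊆ S₂ := by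
    intro C hC
    rcases hU₁ C hC with h | h | h
    · rcases hU₂ C hC with h' | h' | h'
      · left
        rw [Finset.inter_union_distrib_left, h, h', Finset.empty_union]
      · exact Or.inr (Or.inr (Or.inr h'))
      · have : p ∈ C ∩ S₁ := Finset.mem_inter.mpr ⟨h' hp₂, hp₁⟩
        rw [h] at this
        simp at this
    · exact Or.inr (Or.inr (Or.inl h))
    · rcases hU₂ C hC with h' | h' | h'
      · have : p ∈ C ∩ S₂ := Finset.mem_inter.mpr ⟨h hp₁, hp₂⟩
        rw [h'] at this
        simp at this
      · exact Or.inr (Or.inr (Or.inr h'))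
      · exact Or.inr (Or.inl (Finset.union_subset h h'))
  have same : ∀ S : Finset α, PairwiseCompatible (restrictTo 𝒞 S) → ∀ A ∈ 𝒞, ∀ B ∈ 𝒞,
      A ⊆ S → B ⊆ S → Compatible A B := by
    intro S hP A hA B hB hAS hBS
    rcases A.eq_empty_or_nonempty with h | h
    · left; simp [h]
    rcases B.eq_empty_or_nonempty with h' | h'
    · left; simp [h']
    exact hP A ⟨h, A, hA, (Finset.inter_eq_left.mpr hAS).symm⟩
      B ⟨h', B, hB, (Finset.inter_eq_left.mpr hBS).symm⟩
  have cross : ∀ A ∈ 𝒞, ∀ B ∈ 𝒞, A ⊆ S₁ → B ⊆ S₂ → Compatible A B := by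
    intro A hA B hB hAS hBS
    rcases hU₁ B hB with h | h | h
    · left
      apply Finset.eq_empty_of_forall_notMem
      intro x hx
      obtain ⟨hxA, hxB⟩ := Finset.mem_inter.mp hx
      have : x ∈ B ∩ S₁ := Finset.mem_inter.mpr ⟨hxB, hAS hxA⟩
      rw [h] at this
      simp at this
    · exact same S₁ hP₁ A hA B hB hAS h
    · exact Or.inr (Or.inl (hAS.trans h))
  have symm : ∀ A B : Finset α, Compatible A B → Compatible B A := by
    intro A B h
    rcases h with h | h | h
    · left; rw [Finset.inter_comm]; exact h
    · exact Or.inr (Or.inr h)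
    · exact Or.inr (Or.inl h)
  have restr : ∀ A B S : Finset α, Compatible A B → Compatible (A ∩ S) (B ∩ S) := by
    intro A B S h
    rcases h with h | h | h
    · left
      rw [← Finset.inter_inter_distrib_right, h, Finset.empty_inter]
    · exact Or.inr (Or.inl (Finset.inter_subset_inter_right h))
    · exact Or.inr (Or.inr (Finset.inter_subset_inter_right h))
  refine ⟨Finset.union_subset hX₁ hX₂, ?_, ?_⟩
  · intro C hC
    rcases key C hC with h | h | h | h
    · exact Or.inl h
    · exact Or.inr (Or.inr h)
    · exact Or.inr (Or.inl (h.trans Finset.subset_union_left))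
    · exact Or.inr (Or.inl (h.trans Finset.subset_union_right))
  · rintro _ ⟨hAne, A, hA, rfl⟩ _ ⟨hBne, B, hB, rfl⟩
    rcases key A hA with h | h | h | h
    · exact absurd h hAne.ne_empty
    · right; right
      rw [Finset.inter_eq_right.mpr h]
      exact Finset.inter_subset_right
    all_goals
      rcases key B hB with h' | h' | h' | h'
      · exact absurd h' hBne.ne_empty
      · right; left
        rw [Finset.inter_eq_right.mpr h']
        exact Finset.inter_subset_right
      all_goals apply restr
    · exact same S₁ hP₁ A hA B hB h h'
    · exact cross A hA B hB h h'
    · exact symm _ _ (cross B hB A hA h' h)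
    · exact same S₂ hP₂ A hA B hB h h'

end Phylo
end

section
/- Let C be a set of clusters on a finite taxa set X and let S_1 ≠ S_2 be two maximal ST-sets of C. Then S_1 ∩ S_2 = ∅. -/
open scoped Classical

namespace Phylo

variable {α : Type} [DecidableEq α]

/-- Two distinct maximal ST-sets of a cluster set `𝒞` on `X` are
disjoint. -/
theorem maxSTSets_disjoint {α : Type} [DecidableEq α] (X : Finset α)
    (𝒞 : Set (Finset α)) (h𝒞 : IsClusterSet X 𝒞)
    (S₁ S₂ : Finset α) (h₁ : IsMaxSTSet X 𝒞 S₁) (h₂ : IsMaxSTSet X 𝒞 S₂)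
    (hne : S₁ ≠ S₂) :
    S₁ ∩ S₂ = ∅ := by
  by_contra hx
  obtain ⟨x, hx⟩ := Finset.nonempty_iff_ne_empty.mpr hx
  have hx1 : x ∈ S₁ := (Finset.mem_inter.mp hx).1
  have hx2 : x ∈ S₂ := (Finset.mem_inter.mp hx).2
  obtain ⟨⟨hX1, hU1, hP1⟩, hM1⟩ := h₁
  obtain ⟨⟨hX2, hU2, hP2⟩, hM2⟩ := h₂
  -- every cluster misses the union, contains it, or lies in one of the two sets
  have key : ∀ C ∈ 𝒞, C ∩ (S₁ ∪ S₂) = ∅ ∨ S₁ ∪ S₂ ⊆ C ∨ C ⊆ S₁ ∨ C ⊆ S₂ := by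
    intro C hC
    have a := hU1 C hC
    have b := hU2 C hC
    unfold Compatible at a b
    rcases a with a | a | a
    · rcases b with b | b | b
      · left; rw [Finset.inter_union_distrib_left, a, b]; rfl
      · exact Or.inr (Or.inr (Or.inr b))
      · have : x ∈ C ∩ S₁ := Finset.mem_inter.mpr ⟨b hx2, hx1⟩
        rw [a] at this; simp at this
    · exact Or.inr (Or.inr (Or.inl a))
    · rcases b with b | b | b
      · have : x ∈ C ∩ S₂ := Finset.mem_inter.mpr ⟨a hx1, hx2⟩
        rw [b] at this; simp at this
      · exact Or.inr (Or.inr (Or.inr b))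
      · exact Or.inr (Or.inl (Finset.union_subset a b))
  have same : ∀ S : Finset α, PairwiseCompatible (restrictTo 𝒞 S) →
      ∀ A ∈ 𝒞, ∀ B ∈ 𝒞, A ⊆ S → B ⊆ S → Compatible A B := by
    intro S hP A hA B hB hAS hBS
    rcases A.eq_empty_or_nonempty with h | hAn
    · left; simp [h]
    rcases B.eq_empty_or_nonempty with h | hBn
    · left; simp [h]
    exact hP A ⟨hAn, A, hA, (Finset.inter_eq_left.mpr hAS).symm⟩
      B ⟨hBn, B, hB, (Finset.inter_eq_left.mpr hBS).symm⟩
  have symm : ∀ A B : Finset α, Compatible A B → Compatible B A := by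
    rintro A B (h | h | h)
    · left; rw [Finset.inter_comm]; exact h
    · exact Or.inr (Or.inr h)
    · exact Or.inr (Or.inl h)
  have cross : ∀ A ∈ 𝒞, ∀ B ∈ 𝒞, A ⊆ S₁ → B ⊆ S₂ → Compatible A B := by
    intro A hA B hB hAS hBS
    rcases hU2 A hA with h | h | h
    · left
      exact Finset.subset_empty.mp (h ▸ Finset.inter_subset_inter_left hBS)
    · exact same S₂ hP2 A hA B hB h hBS
    · exact Or.inr (Or.inr (hBS.trans h))
  have hST : IsSTSet X 𝒞 (S₁ ∪ S₂) := by
    refine ⟨Finset.union_subset hX1 hX2, ?_, ?_⟩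
    · intro C hC
      rcases key C hC with h | h | h | h
      · exact Or.inl h
      · exact Or.inr (Or.inr h)
      · exact Or.inr (Or.inl (h.trans Finset.subset_union_left))
      · exact Or.inr (Or.inl (h.trans Finset.subset_union_right))
    · rintro _ ⟨hAn, A, hA, rfl⟩ _ ⟨hBn, B, hB, rfl⟩
      have red : ∀ C ∈ 𝒞, (C ∩ (S₁ ∪ S₂)).Nonempty → S₁ ∪ S₂ ⊆ C ∨
          (C ∩ (S₁ ∪ S₂) = C ∧ (C ⊆ S₁ ∨ C ⊆ S₂)) := by
        intro C hC hn
        rcases key C hC with h | h | h | h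
        · exact absurd h hn.ne_empty
        · exact Or.inl h
        · exact Or.inr ⟨Finset.inter_eq_left.mpr (h.trans Finset.subset_union_left), Or.inl h⟩
        · exact Or.inr ⟨Finset.inter_eq_left.mpr (h.trans Finset.subset_union_right), Or.inr h⟩
      rcases red A hA hAn with a | ⟨ea, a⟩
      · right; right
        rw [Finset.inter_eq_right.mpr a]; exact Finset.inter_subset_right
      rcases red B hB hBn with b | ⟨eb, b⟩
      · right; left
        rw [Finset.inter_eq_right.mpr b]; exact Finset.inter_subset_right
      rw [ea, eb]
      rcases a with a | a <;> rcases b with b | b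
      · exact same S₁ hP1 A hA B hB a b
      · exact cross A hA B hB a b
      · exact symm _ _ (cross B hB A hA b a)
      · exact same S₂ hP2 A hA B hB a b
  have e1 : S₁ = S₁ ∪ S₂ := by
    by_contra h
    exact hM1 _ hST (Finset.ssubset_iff_subset_ne.mpr ⟨Finset.subset_union_left, h⟩)
  have e2 : S₂ = S₁ ∪ S₂ := by
    by_contra h
    exact hM2 _ hST (Finset.ssubset_iff_subset_ne.mpr ⟨Finset.subset_union_right, h⟩)
  exact hne (e1.trans e2.symm)

end Phylo
end

section
/- Let C be a set of clusters on a finite taxa set X with |X| = n. Then there are at most n maximal ST-sets with respect to C, they are uniquely defined, and they partition X (they are pairwise disjoint and their union is X). -/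
open scoped Classical

namespace Phylo

variable {α : Type} [DecidableEq α]

theorem unsep_cases {S T C : Finset α} {x : α} (hx : x ∈ S) (hy : x ∈ T)
    (h1 : Compatible C S) (h2 : Compatible C T) :
    (C ∩ (S ∪ T) = ∅) ∨ C ⊆ S ∨ C ⊆ T ∨ S ∪ T ⊆ C := by
  rcases h1 with h1 | h1 | h1
  · rcases h2 with h2 | h2 | h2
    · left
      rw [Finset.inter_union_distrib_left, h1, h2, Finset.union_empty]
    · exact Or.inr (Or.inr (Or.inl h2))
    · exfalso
      have : x ∈ C ∩ S := Finset.mem_inter.2 ⟨h2 hy, hx⟩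
      rw [h1] at this
      simp at this
  · exact Or.inr (Or.inl h1)
  · rcases h2 with h2 | h2 | h2
    · exfalso
      have : x ∈ C ∩ T := Finset.mem_inter.2 ⟨h1 hx, hy⟩
      rw [h2] at this
      simp at this
    · exact Or.inr (Or.inr (Or.inl h2))
    · exact Or.inr (Or.inr (Or.inr (Finset.union_subset h1 h2)))

theorem compat_symm {A B : Finset α} (h : Compatible A B) : Compatible B A := by
  rcases h with h | h | h
  · left; rwa [Finset.inter_comm]
  · exact Or.inr (Or.inr h)
  · exact Or.inr (Or.inl h)

theorem compat_of_sub {𝒞 : Set (Finset α)} {S C D : Finset α}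
    (hS : PairwiseCompatible (restrictTo 𝒞 S)) (hC : C ∈ 𝒞) (hD : D ∈ 𝒞)
    (h1 : C ⊆ S) (h2 : D ⊆ S) : Compatible C D := by
  rcases C.eq_empty_or_nonempty with h | h
  · right; left; simp [h]
  rcases D.eq_empty_or_nonempty with h' | h'
  · right; right; simp [h']
  exact hS C ⟨h, C, hC, (Finset.inter_eq_left.2 h1).symm⟩ D
    ⟨h', D, hD, (Finset.inter_eq_left.2 h2).symm⟩

theorem compat_of_sub' {𝒞 : Set (Finset α)} {S T C D : Finset α}
    (hS : PairwiseCompatible (restrictTo 𝒞 T)) (hC : C ∈ 𝒞) (hD : D ∈ 𝒞)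
    (hu : Unseparated 𝒞 T)
    (h1 : C ⊆ S) (h2 : D ⊆ T) : Compatible C D := by
  rcases hu C hC with h | h | h
  · left
    exact Finset.subset_empty.1 (h ▸ Finset.inter_subset_inter_left h2)
  · exact compat_of_sub hS hC hD h h2
  · exact Or.inr (Or.inr (h2.trans h))

theorem compat_inter {C D U : Finset α} (h : Compatible C D) :
    Compatible (C ∩ U) (D ∩ U) := by
  rcases h with h | h | h
  · left
    exact Finset.subset_empty.1 (h ▸ Finset.inter_subset_inter
      Finset.inter_subset_left Finset.inter_subset_left)
  · exact Or.inr (Or.inl (Finset.inter_subset_inter_right h))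
  · exact Or.inr (Or.inr (Finset.inter_subset_inter_right h))

theorem union_isST {X : Finset α} {𝒞 : Set (Finset α)} {S T : Finset α} {x : α}
    (hx : x ∈ S) (hy : x ∈ T) (hS : IsSTSet X 𝒞 S) (hT : IsSTSet X 𝒞 T) :
    IsSTSet X 𝒞 (S ∪ T) := by
  obtain ⟨hSX, hSu, hSp⟩ := hS
  obtain ⟨hTX, hTu, hTp⟩ := hT
  refine ⟨Finset.union_subset hSX hTX, ?_, ?_⟩
  · intro C hC
    rcases unsep_cases hx hy (hSu C hC) (hTu C hC) with h | h | h | h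
    · exact Or.inl h
    · exact Or.inr (Or.inl (h.trans Finset.subset_union_left))
    · exact Or.inr (Or.inl (h.trans Finset.subset_union_right))
    · exact Or.inr (Or.inr h)
  · rintro _ ⟨hA, C, hC, rfl⟩ _ ⟨hB, D, hD, rfl⟩
    have key : ∀ C ∈ 𝒞, (C ∩ (S ∪ T)).Nonempty → C ⊆ S ∨ C ⊆ T ∨ S ∪ T ⊆ C := by
      intro C hC hne
      rcases unsep_cases hx hy (hSu C hC) (hTu C hC) with h | h
      · exact absurd h hne.ne_empty
      · exact h
    rcases key C hC hA with h | h | h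
    · rcases key D hD hB with h' | h' | h'
      · exact compat_inter (compat_of_sub hSp hC hD h h')
      · exact compat_inter (compat_of_sub' hTp hC hD hTu h h')
      · right; left
        exact Finset.subset_inter (Finset.inter_subset_right.trans h') Finset.inter_subset_right
    · rcases key D hD hB with h' | h' | h'
      · exact compat_inter (compat_symm (compat_of_sub' hTp hD hC hTu h' h))
      · exact compat_inter (compat_of_sub hTp hC hD h h')
      · right; left
        exact Finset.subset_inter (Finset.inter_subset_right.trans h') Finset.inter_subset_right
    · right; right
      exact Finset.subset_inter (Finset.inter_subset_right.trans h) Finset.inter_subset_right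

theorem singleton_isST {X : Finset α} {𝒞 : Set (Finset α)} {x : α} (hx : x ∈ X) :
    IsSTSet X 𝒞 {x} := by
  refine ⟨Finset.singleton_subset_iff.2 hx, ?_, ?_⟩
  · intro C _
    by_cases h : x ∈ C
    · exact Or.inr (Or.inr (Finset.singleton_subset_iff.2 h))
    · exact Or.inl (Finset.inter_singleton_of_notMem h)
  · rintro _ ⟨⟨a, ha⟩, C, hC, rfl⟩ _ ⟨⟨b, hb⟩, D, hD, rfl⟩
    right; left
    intro c hc
    simp only [Finset.mem_inter, Finset.mem_singleton] at *
    obtain ⟨hb, rfl⟩ := hb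
    exact ⟨hc.2 ▸ hb, hc.2⟩

theorem exists_max {X : Finset α} {𝒞 : Set (Finset α)} {x : α} (hx : x ∈ X) :
    ∃ S, IsMaxSTSet X 𝒞 S ∧ x ∈ S := by
  obtain ⟨S, hS, hm⟩ := Finset.exists_max_image
    (X.powerset.filter fun S => IsSTSet X 𝒞 S ∧ x ∈ S) Finset.card
    ⟨{x}, by
      rw [Finset.mem_filter, Finset.mem_powerset]
      exact ⟨Finset.singleton_subset_iff.2 hx, singleton_isST hx, Finset.mem_singleton_self x⟩⟩
  rw [Finset.mem_filter] at hS
  refine ⟨S, ⟨hS.2.1, fun S' hS' hlt => ?_⟩, hS.2.2⟩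
  have := hm S' (Finset.mem_filter.2 ⟨Finset.mem_powerset.2 hS'.1, hS', hlt.1 hS.2.2⟩)
  exact absurd (Finset.card_lt_card hlt) (not_lt.2 this)

/-- The maximal ST-sets of a cluster set `𝒞` on `X` (with `|X| = n`)
number at most `n`, are uniquely defined, and partition `X`. -/
theorem maxSTSets_partition {α : Type} [DecidableEq α] (X : Finset α) (hX : X.Nonempty)
    (𝒞 : Set (Finset α)) (h𝒞 : IsClusterSet X 𝒞)
    (M : Finset (Finset α)) (hM : ∀ S : Finset α, S ∈ M ↔ IsMaxSTSet X 𝒞 S) :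
    M.card ≤ X.card ∧
      (∀ S₁ ∈ M, ∀ S₂ ∈ M, S₁ ≠ S₂ → S₁ ∩ S₂ = ∅) ∧
      M.biUnion id = X := by
  have hdisj : ∀ S₁ ∈ M, ∀ S₂ ∈ M, S₁ ≠ S₂ → S₁ ∩ S₂ = ∅ := by
    intro S₁ h₁ S₂ h₂ hne
    rw [hM] at h₁ h₂
    by_contra hcon
    obtain ⟨x, hx⟩ := Finset.nonempty_iff_ne_empty.2 hcon
    rw [Finset.mem_inter] at hx
    have hU := union_isST hx.1 hx.2 h₁.1 h₂.1
    have e1 : S₁ = S₁ ∪ S₂ := by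
      by_contra h
      exact h₁.2 _ hU (Finset.ssubset_iff_subset_ne.2 ⟨Finset.subset_union_left, h⟩)
    have e2 : S₂ = S₁ ∪ S₂ := by
      by_contra h
      exact h₂.2 _ hU (Finset.ssubset_iff_subset_ne.2 ⟨Finset.subset_union_right, h⟩)
    exact hne (e1.trans e2.symm)
  have hun : M.biUnion id = X := by
    ext x
    simp only [Finset.mem_biUnion, id]
    constructor
    · rintro ⟨S, hS, hx⟩
      exact ((hM S).1 hS).1.1 hx
    · intro hx
      obtain ⟨S, hS, hxS⟩ := exists_max (𝒞 := 𝒞) hx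
      exact ⟨S, (hM S).2 hS, hxS⟩
  refine ⟨?_, hdisj, hun⟩
  have hc : M.card ≤ (M.biUnion id).card := by
    apply Finset.card_le_card_biUnion
    · intro S₁ h₁ S₂ h₂ hne
      exact Finset.disjoint_iff_inter_eq_empty.2 (hdisj S₁ h₁ S₂ h₂ hne)
    · intro S hS
      rw [id, Finset.nonempty_iff_ne_empty]
      rintro rfl
      obtain ⟨x, hx⟩ := hX
      exact ((hM ∅).1 hS).2 {x} (singleton_isST hx)
        (Finset.empty_ssubset.2 (Finset.singleton_nonempty x))
  rwa [hun] at hc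

end Phylo
end
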